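/- arXiv:cs/0101026 — 4 statements merged into one kernel-verified Lean document; each statement's English description precedes it below -/
import Mathlib

section
/- It is undecidable, given n ∈ ℕ and a rule g : Fin n × Fin n × Fin n → Fin n, whether the one-dimensional cellular automaton on ℤ with state set Fin n and rule g has invariant histories. Formally, the predicate on the type Σ n : ℕ, (Fin n × Fin n × Fin n → Fin n) that holds at (n, g) if and only if the induced transition function has invariant histories is not a computable predicate (not ComputablePred) with respect to the natural encoding of this type. -/
namespace AsyncUpdating

variable {C S : Type*}

/-- `f` is a transition function for the neighborhood function `N`:
`f ξ x` depends only on the restriction of `ξ` to `N x`. -/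
def IsTransition (N : C → Set C) (f : (C → S) → C → S) : Prop :=
  ∀ (ξ₁ ξ₂ : C → S) (x : C), (∀ y ∈ N x, ξ₁ y = ξ₂ y) → f ξ₁ x = f ξ₂ x

/-- The automaton is local: every neighborhood is finite. -/
def IsLocal (N : C → Set C) : Prop := ∀ x, (N x).Finite

open Classical in
/-- `upd f ξ E` is the configuration `f(ξ, E)`: apply `f` at the sites of `E` only. -/
noncomputable def upd (f : (C → S) → C → S) (ξ : C → S) (E : Set C) : C → S :=
  fun x => if x ∈ E then f ξ x else ξ x

/-- The set `L(ξ)` of free sites. -/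
def freeSet (f : (C → S) → C → S) (ξ : C → S) : Set C := {x | f ξ x ≠ ξ x}

/-- `η` is an asynchronous trajectory of `f`. -/
def IsAsyncTraj (f : (C → S) → C → S) (η : C → ℕ → S) : Prop :=
  ∀ x t, η x (t + 1) ≠ η x t → η x (t + 1) = f (fun y => η y t) x

/-- `η` is a synchronous trajectory of `f`. -/
def IsSyncTraj (f : (C → S) → C → S) (η : C → ℕ → S) : Prop :=
  ∀ x t, η x (t + 1) = f (fun y => η y t) x

/-- The synchronous trajectory of `f` with initial configuration `ξ`. -/
def syncTraj (f : (C → S) → C → S) (ξ : C → S) : ℕ → C → S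
  | 0 => ξ
  | t + 1 => f (syncTraj f ξ t)

/-- The update set `U(t, η)`. -/
def updSet (η : C → ℕ → S) (t : ℕ) : Set C := {x | η x (t + 1) ≠ η x t}

open Classical in
/-- The effective age `τ(x, t, η)`: the number of `s < t` with `x ∈ U(s, η)`. -/
noncomputable def effAge (η : C → ℕ → S) (x : C) (t : ℕ) : ℕ :=
  ((Finset.range t).filter fun s => η x (s + 1) ≠ η x s).card

/-- `f` has invariant histories. -/
def InvariantHistories (f : (C → S) → C → S) : Prop :=
  ∀ ξ : C → S, ∃ ζ : C → ℕ → S, ∀ η : C → ℕ → S,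
    IsAsyncTraj f η → (∀ x, η x 0 = ξ x) → ∀ x t, η x t = ζ x (effAge η x t)

/-- `f` is monotonic: `L(t,η) \ U(t,η) ⊆ L(t+1,η)` for every asynchronous trajectory. -/
def Monotonic (f : (C → S) → C → S) : Prop :=
  ∀ η : C → ℕ → S, IsAsyncTraj f η → ∀ t,
    freeSet f (fun x => η x t) \ updSet η t ⊆ freeSet f (fun x => η x (t + 1))

/-- `f` is commutative. -/
def CommutativeRule (f : (C → S) → C → S) : Prop :=
  ∀ (ξ : C → S) (A B : Set C), Disjoint A B →
    A ⊆ freeSet f ξ → B ⊆ freeSet f ξ →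
    upd f (upd f ξ A) B = upd f ξ (A ∪ B)

/-- `f` is locally commutative. -/
def LocallyCommutative (f : (C → S) → C → S) : Prop :=
  ∀ (ξ : C → S) (x y : C), x ≠ y → x ∈ freeSet f ξ → y ∈ freeSet f ξ →
    upd f (upd f ξ {x}) {y} = upd f ξ {x, y}

/-- `η₁` dominates `η₀` (they are assumed to have the same initial configuration). -/
def Dominates (η₁ η₀ : C → ℕ → S) : Prop :=
  (∀ x t, effAge η₀ x t ≤ effAge η₁ x t) ∧
  (∀ x t₀ t₁, effAge η₀ x t₀ = effAge η₁ x t₁ → η₀ x t₀ = η₁ x t₁)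

/-- Neighborhoods of the one-dimensional cellular automaton on `ℤ`. -/
def caN (x : ℤ) : Set ℤ := {x - 1, x, x + 1}

/-- Transition function of the one-dimensional cellular automaton on `ℤ` with rule `g`. -/
def caF {S : Type*} (g : S × S × S → S) (ξ : ℤ → S) (x : ℤ) : S :=
  g (ξ (x - 1), ξ x, ξ (x + 1))

theorem primrec_nat_pow : Primrec₂ ((· ^ ·) : ℕ → ℕ → ℕ) :=
  Primrec₂.unpaired'.1 Nat.Primrec.pow

/-- The natural `Primcodable` encoding of a sigma type of finite types over `ℕ`:
`⟨n, g⟩` is coded by the pair of `n` and the rank of `g` in `β n`. -/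
noncomputable def primcodableSigmaFin (β : ℕ → Type) [∀ n, Fintype (β n)]
    (c : ℕ → ℕ) (hc : ∀ n, Fintype.card (β n) = c n) (hprim : Primrec c) :
    Primcodable (Σ n, β n) :=
  letI : Primcodable {p : ℕ × ℕ // p.2 < c p.1} :=
    Primcodable.subtype (Primrec.nat_lt.comp Primrec.snd (hprim.comp Primrec.fst))
  Primcodable.ofEquiv {p : ℕ × ℕ // p.2 < c p.1}
    { toFun := fun q => ⟨(q.1, Fintype.equivFin (β q.1) q.2), by
        simpa [hc] using (Fintype.equivFin (β q.1) q.2).isLt⟩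
      invFun := fun p => ⟨p.1.1, (Fintype.equivFin (β p.1.1)).symm ⟨p.1.2, by
        simpa [hc] using p.2⟩⟩
      left_inv := fun q => by simp
      right_inv := fun p => by
        rcases p with ⟨⟨n, k⟩, h⟩
        simp }

/-- The natural encoding of the type of pairs `(n, g)` of a state count and a rule. -/
noncomputable instance : Primcodable (Σ n : ℕ, Fin n × Fin n × Fin n → Fin n) :=
  primcodableSigmaFin _ (fun n => n ^ (n * (n * n))) (fun n => by simp)
    (primrec_nat_pow.comp .id
      (Primrec.nat_mul.comp .id (Primrec.nat_mul.comp .id .id)))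

section Input

open Turing

theorem exists_partrec_two_pow {p : ℕ → Prop} (hp : REPred p) :
    ∃ f : ℕ →. ℕ, Partrec f ∧ ∀ e, (f (2 ^ e)).Dom ↔ p e := by
  have h2 : Primrec (fun k : ℕ => 2 ^ k) :=
    (Primrec₂.unpaired'.1 Nat.Primrec.pow).comp (.const 2) .id
  have heq : Partrec₂ fun m k : ℕ => Part.some (decide (2 ^ k = m)) :=
    ((Primrec.eq.comp (h2.comp Primrec.snd) Primrec.fst).decide.to_comp).partrec
  let q : ℕ → ℕ →. Bool := fun m k => Part.some (decide (2 ^ k = m))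
  refine ⟨fun m => (Nat.rfind (q m)).bind fun k =>
    (Part.assert (p k) fun _ => Part.some ()).map fun _ => 0, ?_, fun e => ?_⟩
  · exact (Partrec.rfind heq).bind
      ((hp.comp Computable.snd).map ((Computable.const 0).comp Computable.fst).to₂)
  · have hq : Nat.rfind (q (2 ^ e)) = Part.some e := by
      refine Part.eq_some_iff.2 (Nat.mem_rfind.2 ⟨by simp [q], fun {m} hm => ?_⟩)
      have : (2 : ℕ) ^ m ≠ 2 ^ e := fun h => hm.ne (Nat.pow_right_injective le_rfl h)
      simp [q, this]
    change ((Nat.rfind (q (2 ^ e))).bind _).Dom ↔ _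
    rw [hq, Part.bind_some]
    simp [Part.assert]

theorem trNat_two_pow (e : ℕ) :
    PartrecToTM2.trNat (2 ^ e) =
      List.replicate e PartrecToTM2.Γ'.bit0 ++ [PartrecToTM2.Γ'.bit1] := by
  have h : ∀ e, ((2 ^ e : ℕ) : Num) = Num.pos (Nat.rec PosNum.one (fun _ p => p.bit0) e) := by
    intro e
    induction e with
    | zero => rfl
    | succ e ih =>
      have : ((2 ^ (e + 1) : ℕ) : Num) = Num.bit0 ((2 ^ e : ℕ) : Num) := by
        rw [pow_succ, mul_two, Nat.cast_add, Num.bit0_of_bit0]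
      rw [this, ih]; rfl
  rw [PartrecToTM2.trNat, h]
  induction e with
  | zero => rfl
  | succ e ih => exact congrArg (PartrecToTM2.Γ'.bit0 :: ·) ih

theorem exists_fintype_of_supports {Γ Λ : Type} [Inhabited Γ] [Inhabited Λ]
    (M : TM0.Machine Γ Λ) (S : Finset Λ) (hS : TM0.Supports M (S : Set Λ)) :
    ∃ (Λ' : Type) (_ : Inhabited Λ') (_ : Fintype Λ') (M' : TM0.Machine Γ Λ'),
      ∀ l, (TM0.eval M' l).Dom ↔ (TM0.eval M l).Dom := by
  classical
  let d : S := ⟨default, hS.1⟩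
  let _ : Inhabited S := ⟨d⟩
  let g₁ : PointedMap Λ S := ⟨fun q => if h : q ∈ S then ⟨q, h⟩ else d, dif_pos hS.1⟩
  let i : PointedMap Γ Γ := ⟨id, rfl⟩
  have hg : ∀ q ∈ (S : Set Λ), ((g₁ q : S) : Λ) = q := fun q hq => by
    have : g₁ q = ⟨q, hq⟩ := dif_pos hq
    rw [this]
  refine ⟨S, inferInstance, inferInstance, M.map i i g₁ Subtype.val, fun l => ?_⟩
  have h := StateTransition.tr_eval_dom
    (TM0.Machine.map_respects M i i g₁ Subtype.val hS (fun _ => rfl) hg)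
    (a₁ := TM0.init l) (a₂ := TM0.init l) ⟨hS.1, by
      have := TM0.map_init i g₁ l
      rw [this]; congr 1; exact List.map_id l⟩
  exact h

/-- Every recursively enumerable predicate is the halting predicate of a fixed machine with
finitely many symbols and labels, on inputs that are unary after a fixed initial word. -/
theorem exists_tm0 {p : ℕ → Prop} (hp : REPred p) :
    ∃ (Γ Λ : Type) (_ : Inhabited Γ) (_ : Fintype Γ) (_ : Inhabited Λ) (_ : Fintype Λ)
      (M : TM0.Machine Γ Λ) (a b z : Γ),
      ∀ e, (TM0.eval M (a :: b :: List.replicate e z)).Dom ↔ p e := by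
  classical
  obtain ⟨f, hf, hfp⟩ := exists_partrec_two_pow hp
  obtain ⟨c, hc⟩ := ToPartrec.Code.exists_code (Nat.Partrec'.part_iff₁.2 hf)
  let _ : Inhabited PartrecToTM2.Λ' := ⟨PartrecToTM2.trNormal c PartrecToTM2.Cont'.halt⟩
  let M₂ := PartrecToTM2.tr
  let _ : Fintype PartrecToTM2.K' := ⟨{.main, .rev, .aux, .stack}, fun k => by cases k <;> simp⟩
  let M₁ := TM2to1.tr M₂
  let M₀ := TM1to0.tr M₁
  have s₁ : TM1.Supports M₁ _ := TM2to1.tr_supports M₂ (PartrecToTM2.tr_supports c .halt)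
  obtain ⟨Λ, _, _, M, hM⟩ := exists_fintype_of_supports M₀ _ (TM1to0.tr_supports M₁ s₁)
  let u : PartrecToTM2.Γ' → ∀ k : PartrecToTM2.K', Option PartrecToTM2.Γ' := fun x =>
    Function.update (fun _ => none) .main (some x)
  refine ⟨TM2to1.Γ' PartrecToTM2.K' fun _ => PartrecToTM2.Γ', Λ, inferInstance, inferInstance,
    inferInstance, inferInstance, M, (true, u .cons), (false, u .bit1), (false, u .bit0),
    fun e => ?_⟩
  have hinit : ((true, u .cons) :: (false, u .bit1) :: List.replicate e (false, u .bit0) :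
      List (TM2to1.Γ' PartrecToTM2.K' fun _ => PartrecToTM2.Γ')) =
      TM2to1.trInit (Γ := fun _ => PartrecToTM2.Γ') PartrecToTM2.K'.main
        (PartrecToTM2.trList [2 ^ e]) := by
    have h : (PartrecToTM2.trList [2 ^ e]).reverse =
        .cons :: .bit1 :: List.replicate e .bit0 := by
      simp [PartrecToTM2.trList, trNat_two_pow]
    rw [TM2to1.trInit, h]
    refine congrArg (fun l => (true, u .cons) :: (false, u .bit1) :: l) ?_
    exact (List.map_replicate (f := fun a => ((false, u a) :
      TM2to1.Γ' PartrecToTM2.K' fun _ => PartrecToTM2.Γ'))).symm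
  refine (hM _).trans ?_
  rw [TM1to0.tr_eval]
  refine (iff_of_eq (congrArg (fun l => (TM1.eval M₁ l).Dom) hinit)).trans ?_
  refine (TM2to1.tr_eval_dom M₂ _ _).trans ?_
  rw [← hfp e]
  have h₁ : (TM2.init .main (PartrecToTM2.trList [2 ^ e]) : PartrecToTM2.Cfg') =
      PartrecToTM2.init c [2 ^ e] := by
    unfold TM2.init PartrecToTM2.init
    congr 1
    funext k; cases k <;> rfl
  have h₂ := PartrecToTM2.tr_eval c [2 ^ e]
  rw [← h₁] at h₂
  have h₃ := hc ⟨[2 ^ e], rfl⟩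
  change (StateTransition.eval (TM2.step PartrecToTM2.tr)
    (TM2.init .main (PartrecToTM2.trList [2 ^ e]))).Dom ↔ _
  have h₄ : c.eval [2 ^ e] = pure <$> f (2 ^ e) := h₃
  rw [h₂, h₄]
  rfl

end Input

section General

theorem effAge_zero (η : C → ℕ → S) (x : C) : effAge η x 0 = 0 := by
  simp [effAge]

theorem effAge_succ_of_eq {η : C → ℕ → S} {x : C} {t : ℕ} (h : η x (t + 1) = η x t) :
    effAge η x (t + 1) = effAge η x t := by
  classical
  simp [effAge, Finset.range_add_one, Finset.filter_insert, h]

theorem effAge_succ_of_ne {η : C → ℕ → S} {x : C} {t : ℕ} (h : η x (t + 1) ≠ η x t) :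
    effAge η x (t + 1) = effAge η x t + 1 := by
  classical
  simp [effAge, Finset.range_add_one, Finset.filter_insert, h]

/-- Invariant histories, without reference to the history function. -/
theorem invariantHistories_iff (f : (C → S) → C → S) :
    InvariantHistories f ↔ ∀ η η' : C → ℕ → S, IsAsyncTraj f η → IsAsyncTraj f η' →
      (∀ x, η x 0 = η' x 0) → ∀ x t t', effAge η x t = effAge η' x t' → η x t = η' x t' := by
  constructor
  · intro h η η' hη hη' h0 x t t' hage
    obtain ⟨ζ, hζ⟩ := h fun x => η x 0
    rw [hζ η hη (fun _ => rfl), hζ η' hη' (fun x => (h0 x).symm), hage]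
  · intro h ξ
    classical
    let P : C → ℕ → S → Prop := fun x k s => ∃ η : C → ℕ → S, IsAsyncTraj f η ∧
      (∀ y, η y 0 = ξ y) ∧ ∃ t, effAge η x t = k ∧ η x t = s
    refine ⟨fun x k => if hk : ∃ s, P x k s then hk.choose else ξ x, fun η hη h0 x t => ?_⟩
    have hk : ∃ s, P x (effAge η x t) s := ⟨_, η, hη, h0, t, rfl, rfl⟩
    obtain ⟨η', hη', h0', t', hage, hs⟩ := hk.choose_spec
    refine Eq.trans ?_ (hs.trans (dif_pos hk).symm)
    exact h η η' hη hη' (fun y => (h0 y).trans (h0' y).symm) x t t' hage.symm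

/-- The trajectory that follows `η` up to time `t` and stays constant afterwards. -/
theorem IsAsyncTraj.freeze {f : (C → S) → C → S} {η : C → ℕ → S} (h : IsAsyncTraj f η) (t : ℕ) :
    IsAsyncTraj f fun x s => η x (min s t) := by
  intro x s hs
  rcases lt_or_ge s t with hst | hst
  · simp only [min_eq_left (Nat.succ_le_of_lt hst), min_eq_left hst.le] at hs ⊢
    exact h x s hs
  · exact absurd (by simp only [min_eq_right hst, min_eq_right (hst.trans s.le_succ)]) hs

theorem effAge_congr {η η' : C → ℕ → S} {x : C} {t : ℕ} (h : ∀ s ≤ t, η x s = η' x s) :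
    effAge η x t = effAge η' x t := by
  induction t with
  | zero => simp [effAge_zero]
  | succ t ih =>
    have ih := ih fun s hs => h s (by omega)
    by_cases hc : η x (t + 1) = η x t
    · rw [effAge_succ_of_eq hc, effAge_succ_of_eq, ih]
      rw [← h _ le_rfl, ← h t (by omega), hc]
    · rw [effAge_succ_of_ne hc, effAge_succ_of_ne, ih]
      rwa [← h _ le_rfl, ← h t (by omega)]

theorem effAge_freeze {η : C → ℕ → S} {x : C} {t s : ℕ} (h : t ≤ s) :
    effAge (fun x s => η x (min s t)) x s = effAge η x t := by
  induction s, h using Nat.le_induction with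
  | base => exact effAge_congr fun s hs => by rw [min_eq_left hs]
  | succ s hs ih =>
    rw [effAge_succ_of_eq, ih]
    simp only [min_eq_right hs, min_eq_right (hs.trans s.le_succ)]

/-- It suffices to compare trajectories at equal times. -/
theorem invariantHistories_iff_same_time (f : (C → S) → C → S) :
    InvariantHistories f ↔ ∀ η η' : C → ℕ → S, IsAsyncTraj f η → IsAsyncTraj f η' →
      (∀ x, η x 0 = η' x 0) → ∀ x t, effAge η x t = effAge η' x t → η x t = η' x t := by
  rw [invariantHistories_iff]
  refine ⟨fun h η η' hη hη' h0 x t => h η η' hη hη' h0 x t t, fun h η η' hη hη' h0 x t t' ha => ?_⟩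
  have := h _ _ (hη.freeze t) (hη'.freeze t') (by simpa using h0) x (max t t')
    (by rwa [effAge_freeze (le_max_left _ _), effAge_freeze (le_max_right _ _)])
  simpa using this

end General

/-- Invariant histories pass to the domain of an injective morphism of rules. -/
theorem InvariantHistories.of_injective {S S' : Type*} {g : S × S × S → S}
    {g' : S' × S' × S' → S'} (φ : S' → S) (hφ : Function.Injective φ)
    (hg : ∀ a b c, φ (g' (a, b, c)) = g (φ a, φ b, φ c))
    (h : InvariantHistories (caF g)) : InvariantHistories (caF g') := by
  rw [invariantHistories_iff] at h ⊢
  have htr : ∀ η : ℤ → ℕ → S', IsAsyncTraj (caF g') η →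
      IsAsyncTraj (caF g) fun x t => φ (η x t) := by
    intro η hη x t hne
    have := hη x t fun h => hne (congrArg φ h)
    simp only [this, caF, hg]
  have hag : ∀ (η : ℤ → ℕ → S') x t, effAge (fun x t => φ (η x t)) x t = effAge η x t := by
    intro η x t
    unfold effAge
    congr! 2
    simp only [hφ.ne_iff]
  intro η η' hη hη' h0 x t t' ha
  exact hφ (h _ _ (htr η hη) (htr η' hη') (fun x => congrArg φ (h0 x)) x t t' (by rwa [hag, hag]))

/-- Invariant histories do not depend on the names of the states. -/
theorem invariantHistories_congr {S S' : Type*} {g : S × S × S → S} {g' : S' × S' × S' → S'}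
    (φ : S' ≃ S) (hg : ∀ a b c, φ (g' (a, b, c)) = g (φ a, φ b, φ c)) :
    InvariantHistories (caF g) ↔ InvariantHistories (caF g') :=
  ⟨.of_injective φ φ.injective hg, .of_injective φ.symm φ.symm.injective fun a b c => by
    simp [Equiv.symm_apply_eq, hg]⟩

section Counter

/-- The effect of an instruction on a counter: keep it, reset it to its maximum, decrement it. -/
def counterStep {e : ℕ} : Option Bool → Fin (e + 1) → Fin (e + 1)
  | none, i => i
  | some true, _ => Fin.last e
  | some false, i => ⟨i - 1, by omega⟩

/-- The rule on states consisting of a counter and a control part in `Q`, where the control part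
only tests whether the counter is zero. -/
def counterRule {Q : Type} (e : ℕ) (A : Q → Q → Q → Option Bool) (T : Q → Q → Q → Bool → Q) :
    (Fin (e + 1) × Q) × (Fin (e + 1) × Q) × (Fin (e + 1) × Q) → Fin (e + 1) × Q :=
  fun s => (counterStep (A s.1.2 s.2.1.2 s.2.2.2) s.2.1.1,
    T s.1.2 s.2.1.2 s.2.2.2 (decide (s.2.1.1 = 0)))

end Counter

/-- Commands passed from each cell to its right neighbor. The command `left c` announces that the
head has moved to the left after writing `c`, similarly for `right c`. -/
inductive Cmd (Γ : Type)
  | reset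
  | noop
  | left (c : Γ)
  | right (c : Γ)

/-- Contents of a cell: either the head of the simulated machine (in the states `start`, `pre`,
`run`, `halt`), or one level of its two stacks. -/
inductive Datum (Γ Λ : Type)
  | start
  | pre (c : Cmd Γ)
  | run (q : Λ) (a : Γ) (c : Cmd Γ)
  | halt
  | mem (c : Cmd Γ) (l r : Γ)

/-- Control states: walls, which record what they have seen, and cells with a stamp. -/
abbrev Control (Γ Λ : Type) := Option Bool ⊕ Bool × Datum Γ Λ

instance {Γ : Type} [Finite Γ] : Finite (Cmd Γ) :=
  Finite.of_injective (β := Option (Option (Γ ⊕ Γ)))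
    (fun | .reset => none | .noop => some none | .left c => some (some (.inl c))
         | .right c => some (some (.inr c)))
    (by intro x y; cases x <;> cases y <;> simp)

instance {Γ Λ : Type} [Finite Γ] [Finite Λ] : Finite (Datum Γ Λ) :=
  Finite.of_injective
    (β := Option (Option (Cmd Γ ⊕ (Λ × Γ × Cmd Γ) ⊕ (Cmd Γ × Γ × Γ))))
    (fun | .start => none | .halt => some none | .pre c => some (some (.inl c))
         | .run q a c => some (some (.inr (.inl (q, a, c))))
         | .mem c l r => some (some (.inr (.inr (c, l, r)))))
    (by intro x y; cases x <;> cases y <;> simp)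

section Rule
variable {Γ Λ : Type}

/-- The full states: a counter and a control state. -/
abbrev State (e : ℕ) (Γ Λ : Type) := Fin (e + 1) × Control Γ Λ

/-- The command displayed by a datum. -/
def Datum.cmd : Datum Γ Λ → Cmd Γ
  | .start => .reset
  | .pre c => c
  | .run _ _ c => c
  | .halt => .noop
  | .mem c _ _ => c

/-- The symbols stored in a datum. -/
def Datum.tops [Inhabited Γ] : Datum Γ Λ → Γ × Γ
  | .mem _ l r => (l, r)
  | _ => default

/-- The command displayed by a control state. -/
def Control.cmd : Control Γ Λ → Cmd Γ
  | .inl _ => .noop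
  | .inr (_, d) => d.cmd

/-- The symbols stored in a control state. -/
def Control.tops [Inhabited Γ] : Control Γ Λ → Γ × Γ
  | .inl _ => default
  | .inr (_, d) => d.tops

/-- The stamp of a control state; walls have none. -/
def Control.stamp : Control Γ Λ → Option Bool
  | .inl _ => none
  | .inr (p, _) => some p

theorem State.exists_eq_of_stamp_ne_none {e : ℕ} {s : State e Γ Λ} (h : s.2.stamp ≠ none) :
    ∃ i p d, s = (i, .inr (p, d)) := by
  obtain ⟨i, w | ⟨p, d⟩⟩ := s
  · exact absurd rfl h
  · exact ⟨i, p, d, rfl⟩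

theorem State.exists_eq_of_stamp_eq_none {e : ℕ} {s : State e Γ Λ} (h : s.2.stamp = none) :
    ∃ i w, s = (i, .inl w) := by
  obtain ⟨i, w | ⟨p, d⟩⟩ := s
  · exact ⟨i, w, rfl⟩
  · cases h

/-- Whether two states have different stamps. -/
def gap {e : ℕ} (s s' : State e Γ Λ) : ℕ := if s.2.stamp = s'.2.stamp then 0 else 1

/-- The age difference between the cells `y + j` and `y` caused by the initial stamps. -/
def ageOffset {e : ℕ} (ξ : ℤ → State e Γ Λ) (y : ℤ) (j : ℕ) : ℕ :=
  ∑ i ∈ Finset.range j, gap (ξ (y + i)) (ξ (y + i + 1))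

theorem ageOffset_succ {e : ℕ} (ξ : ℤ → State e Γ Λ) (y : ℤ) (j : ℕ) :
    ageOffset ξ y (j + 1) = ageOffset ξ y j + gap (ξ (y + j)) (ξ (y + j + 1)) :=
  Finset.sum_range_succ _ _

/-- A machine together with the symbols `a b z` that make up its inputs `a b zᵉ`. -/
structure InputMachine (Γ Λ : Type) [Inhabited Λ] where
  /-- the machine -/
  M : Turing.TM0.Machine Γ Λ
  /-- first symbol -/
  a : Γ
  /-- second symbol -/
  b : Γ
  /-- repeated symbol -/
  z : Γ

variable [Inhabited Γ] [Inhabited Λ] (I : InputMachine Γ Λ)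

/-- One step of a datum, given the command of the left neighbor, the symbols stored in the right
neighbor, and whether the counter is zero. -/
def InputMachine.nextDatum : Cmd Γ → Datum Γ Λ → Γ × Γ → Bool → Datum Γ Λ
  | .reset, _, _, _ => .mem .reset default default
  | _, .start, _, _ => .pre .reset
  | _, .pre _, _, true => .run default I.a (.left I.b)
  | _, .pre _, _, false => .pre (.left I.z)
  | _, .run q s _, t, _ =>
    match I.M q s with
    | none => .halt
    | some (q', .write c) => .run q' c .noop
    | some (q', .move .right) => .run q' t.2 (.right s)
    | some (q', .move .left) => .run q' t.1 (.left s)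
  | _, .halt, _, _ => .halt
  | .noop, .mem _ l r, _, _ => .mem .noop l r
  | .right c, .mem _ l _, t, _ => .mem (.right l) c t.2
  | .left c, .mem _ _ r, t, _ => .mem (.left r) t.1 c

/-- The effect of a step on the counter. -/
def nextCounter : Cmd Γ → Datum Γ Λ → Option Bool
  | .reset, _ => none
  | _, .start => some true
  | _, .pre _ => some false
  | _, _ => none

/-- One step of a counter and a datum. -/
def InputMachine.next {e : ℕ} (c : Cmd Γ) (d : Fin (e + 1) × Datum Γ Λ) (t : Γ × Γ) :
    Fin (e + 1) × Datum Γ Λ :=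
  (counterStep (nextCounter c d.2) d.1, I.nextDatum c d.2 t (decide (d.1 = 0)))

/-- What an undecided wall becomes. -/
def wallStep : Control Γ Λ → Option Bool
  | .inr (_, .start) => some false
  | .inr (_, .halt) => some true
  | _ => none

/-- The control part of the rule. -/
def InputMachine.control (l c r : Control Γ Λ) (zero : Bool) : Control Γ Λ :=
  match c with
  | .inl none => .inl (wallStep r)
  | .inl (some w) => .inl (some w)
  | .inr (p, d) => if l.stamp ≠ some p ∧ r.stamp = some p then
      .inr (!p, I.nextDatum l.cmd d r.tops zero) else .inr (p, d)

/-- The counter part of the rule. -/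
def counterControl (l c r : Control Γ Λ) : Option Bool :=
  match c with
  | .inl _ => none
  | .inr (p, d) => if l.stamp ≠ some p ∧ r.stamp = some p then nextCounter l.cmd d else none

/-- The rule of the automaton that simulates the machine on the input `a b zᵉ`. -/
def InputMachine.rule (e : ℕ) := counterRule e (Q := Control Γ Λ) counterControl I.control

/-- The ideal history: entry `h j` is the content of cell `j` after `h` updates. -/
def InputMachine.row (e : ℕ) : ℕ → ℕ → Fin (e + 1) × Datum Γ Λ
  | 0, 0 => (0, .start)
  | 0, _ + 1 => (0, .mem .reset default default)
  | h + 1, 0 => I.next .noop (row e h 0) (row e h 1).2.tops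
  | h + 1, j + 1 => I.next (row e (h + 1) j).2.cmd (row e h (j + 1)) (row e h (j + 2)).2.tops

variable {I} {e : ℕ}

theorem rule_wall (l r : Fin (e + 1) × Control Γ Λ) (i : Fin (e + 1)) :
    I.rule e (l, (i, .inl none), r) = (i, .inl (wallStep r.2)) := rfl

theorem rule_inert (l r : Fin (e + 1) × Control Γ Λ) (i : Fin (e + 1)) (w : Bool) :
    I.rule e (l, (i, .inl (some w)), r) = (i, .inl (some w)) := rfl

theorem rule_cell_of_active {l r : Fin (e + 1) × Control Γ Λ} {p : Bool} (i : Fin (e + 1))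
    (d : Datum Γ Λ) (h : l.2.stamp ≠ some p ∧ r.2.stamp = some p) :
    I.rule e (l, (i, .inr (p, d)), r) = ((I.next l.2.cmd (i, d) r.2.tops).1,
      .inr (!p, (I.next l.2.cmd (i, d) r.2.tops).2)) := by
  simp only [InputMachine.rule, counterRule, counterControl, InputMachine.control, if_pos h,
    InputMachine.next]

theorem rule_cell_of_not_active {l r : Fin (e + 1) × Control Γ Λ} {p : Bool} (i : Fin (e + 1))
    (d : Datum Γ Λ) (h : ¬ (l.2.stamp ≠ some p ∧ r.2.stamp = some p)) :
    I.rule e (l, (i, .inr (p, d)), r) = (i, .inr (p, d)) := by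
  simp only [InputMachine.rule, counterRule, counterControl, InputMachine.control, if_neg h,
    counterStep]

end Rule

section Machine

open Turing

variable {Γ Λ : Type} [Inhabited Γ] [Inhabited Λ] {I : InputMachine Γ Λ} {e : ℕ}

theorem IsAsyncTraj.cell_update {η : ℤ → ℕ → State e Γ Λ} (hη : IsAsyncTraj (caF (I.rule e)) η)
    {x : ℤ} {t : ℕ} (h : η x (t + 1) ≠ η x t) {i : Fin (e + 1)} {p : Bool} {d : Datum Γ Λ}
    (hx : η x t = (i, .inr (p, d))) :
    ((η (x - 1) t).2.stamp ≠ some p ∧ (η (x + 1) t).2.stamp = some p) ∧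
      η x (t + 1) = ((I.next (η (x - 1) t).2.cmd (i, d) (η (x + 1) t).2.tops).1,
        .inr (!p, (I.next (η (x - 1) t).2.cmd (i, d) (η (x + 1) t).2.tops).2)) := by
  have h' := hη x t h
  simp only [caF, hx] at h'
  by_cases ha : (η (x - 1) t).2.stamp ≠ some p ∧ (η (x + 1) t).2.stamp = some p
  · exact ⟨ha, h'.trans (rule_cell_of_active i d ha)⟩
  · exact absurd ((h'.trans (rule_cell_of_not_active i d ha)).trans hx.symm) h

theorem IsAsyncTraj.wall_update {η : ℤ → ℕ → State e Γ Λ} (hη : IsAsyncTraj (caF (I.rule e)) η)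
    {x : ℤ} {t : ℕ} (h : η x (t + 1) ≠ η x t) {i : Fin (e + 1)} {w : Option Bool}
    (hx : η x t = (i, .inl w)) :
    w = none ∧ η x (t + 1) = (i, .inl (wallStep (η (x + 1) t).2)) := by
  have h' := hη x t h
  simp only [caF, hx] at h'
  cases w with
  | none => exact ⟨rfl, h'.trans (rule_wall _ _ i)⟩
  | some w => exact absurd ((h'.trans (rule_inert _ _ i w)).trans hx.symm) h

theorem IsAsyncTraj.stamp_eq_none_iff {η : ℤ → ℕ → State e Γ Λ}
    (hη : IsAsyncTraj (caF (I.rule e)) η) (x : ℤ) (t : ℕ) :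
    (η x t).2.stamp = none ↔ (η x 0).2.stamp = none := by
  induction t with
  | zero => rfl
  | succ t ih =>
    rw [← ih]
    by_cases h : η x (t + 1) = η x t
    · rw [h]
    rcases hx : η x t with ⟨i, w | ⟨p, d⟩⟩
    · rw [(hη.wall_update h hx).2]; rfl
    · rw [(hη.cell_update h hx).2]; simp [Control.stamp]

/-- The age difference of adjacent cells is controlled by their stamps. -/
theorem IsAsyncTraj.age_add_gap {η : ℤ → ℕ → State e Γ Λ} (hη : IsAsyncTraj (caF (I.rule e)) η)
    {x y : ℤ} (hxy : y = x + 1) (hx : (η x 0).2.stamp ≠ none) (hy : (η y 0).2.stamp ≠ none)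
    (s : ℕ) :
    effAge η x s + gap (η x 0) (η y 0) = effAge η y s + gap (η x s) (η y s) := by
  induction s with
  | zero => simp [effAge_zero]
  | succ s ih =>
    obtain ⟨i, p, d, hxs⟩ := State.exists_eq_of_stamp_ne_none
      (fun h => hx ((hη.stamp_eq_none_iff x s).1 h))
    obtain ⟨i', p', d', hys⟩ := State.exists_eq_of_stamp_ne_none
      (fun h => hy ((hη.stamp_eq_none_iff y s).1 h))
    have hyx : y - 1 = x := by omega
    by_cases h : η x (s + 1) = η x s <;> by_cases h' : η y (s + 1) = η y s
    · rw [effAge_succ_of_eq h, effAge_succ_of_eq h', h, h', ih]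
    · obtain ⟨⟨h₁, -⟩, h₂⟩ := hη.cell_update h' hys
      rw [effAge_succ_of_eq h, effAge_succ_of_ne h', h, h₂, ih]
      simp only [hyx, hxs, hys, gap, Control.stamp, ne_eq, Option.some.injEq] at h₁ ⊢
      revert h₁; cases p <;> cases p' <;> simp
    · obtain ⟨⟨-, h₁⟩, h₂⟩ := hη.cell_update h hxs
      rw [effAge_succ_of_ne h, effAge_succ_of_eq h', h', h₂]
      simp only [← hxy, hxs, hys, gap, Control.stamp, Option.some.injEq] at h₁ ih ⊢
      revert ih h₁; cases p <;> cases p' <;> simp <;> omega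
    · have h₁ := (hη.cell_update h hxs).1.2
      have h₂ := (hη.cell_update h' hys).1.1
      simp only [hyx, ← hxy, hxs, hys, Control.stamp, ne_eq, Option.some.injEq] at h₁ h₂
      exact absurd h₁.symm h₂

theorem exists_last_update {C S : Type*} {η : C → ℕ → S} {x : C} {t k : ℕ}
    (h : effAge η x t = k + 1) :
    ∃ s < t, η x (s + 1) ≠ η x s ∧ effAge η x s = k ∧ η x t = η x (s + 1) := by
  induction t with
  | zero => simp [effAge_zero] at h
  | succ t ih =>
    by_cases hc : η x (t + 1) = η x t
    · rw [effAge_succ_of_eq hc] at h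
      obtain ⟨s, hs, h₁, h₂, h₃⟩ := ih h
      exact ⟨s, by omega, h₁, h₂, hc.trans h₃⟩
    · rw [effAge_succ_of_ne hc] at h
      exact ⟨t, by omega, hc, by omega, rfl⟩

theorem eq_zero_of_effAge_eq_zero {C S : Type*} {η : C → ℕ → S} {x : C} {t : ℕ}
    (h : effAge η x t = 0) : η x t = η x 0 := by
  induction t with
  | zero => rfl
  | succ t ih =>
    by_cases hc : η x (t + 1) = η x t
    · rw [effAge_succ_of_eq hc] at h
      exact hc.trans (ih h)
    · rw [effAge_succ_of_ne hc] at h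
      omega

/-- The age of the right neighbor of a cell at the time of an update. -/
theorem IsAsyncTraj.effAge_right {η : ℤ → ℕ → State e Γ Λ} (hη : IsAsyncTraj (caF (I.rule e)) η)
    {x y : ℤ} (hxy : y = x + 1) (hx : (η x 0).2.stamp ≠ none) {s : ℕ}
    (h : η x (s + 1) ≠ η x s) :
    (η y 0).2.stamp ≠ none ∧ effAge η y s = effAge η x s + gap (η x 0) (η y 0) := by
  obtain ⟨i, p, d, hxs⟩ := State.exists_eq_of_stamp_ne_none
    (fun h => hx ((hη.stamp_eq_none_iff x s).1 h))
  have h₁ := (hη.cell_update h hxs).1.2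
  rw [← hxy] at h₁
  have hy : (η y 0).2.stamp ≠ none := by
    rw [ne_eq, ← hη.stamp_eq_none_iff y s, h₁]; simp
  refine ⟨hy, ?_⟩
  have := hη.age_add_gap hxy hx hy s
  have h₂ : (η x s).2.stamp = some p := by rw [hxs]; rfl
  have hg : gap (η x s) (η y s) = 0 := by simp [gap, h₁, h₂]
  omega

/-- The age of the left neighbor of a cell at the time of an update. -/
theorem IsAsyncTraj.effAge_left {η : ℤ → ℕ → State e Γ Λ} (hη : IsAsyncTraj (caF (I.rule e)) η)
    {x y : ℤ} (hxy : y = x + 1) (hx : (η x 0).2.stamp ≠ none) (hy : (η y 0).2.stamp ≠ none)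
    {s : ℕ} (h : η y (s + 1) ≠ η y s) :
    effAge η x s + gap (η x 0) (η y 0) = effAge η y s + 1 := by
  obtain ⟨i, p, d, hys⟩ := State.exists_eq_of_stamp_ne_none
    (fun h => hy ((hη.stamp_eq_none_iff y s).1 h))
  have h₁ := (hη.cell_update h hys).1.1
  rw [show y - 1 = x by omega] at h₁
  have := hη.age_add_gap hxy hx hy s
  have hg : gap (η x s) (η y s) = 1 := by simp [gap, hys, Control.stamp] at h₁ ⊢; exact h₁
  omega

/-- Away from the walls, the state is determined by the effective age. -/
theorem IsAsyncTraj.cell_eq {η η' : ℤ → ℕ → State e Γ Λ} (hη : IsAsyncTraj (caF (I.rule e)) η)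
    (hη' : IsAsyncTraj (caF (I.rule e)) η') (h0 : ∀ x, η x 0 = η' x 0) (t : ℕ) :
    ∀ (x : ℤ) (t' : ℕ), (η x 0).2.stamp ≠ none → effAge η x t = effAge η' x t' →
      η x t = η' x t' := by
  induction t using Nat.strong_induction_on with
  | _ t ih =>
  intro x t' hx hage
  have hx' : (η' x 0).2.stamp ≠ none := h0 x ▸ hx
  rcases hk : effAge η x t with _ | k
  · rw [eq_zero_of_effAge_eq_zero hk, eq_zero_of_effAge_eq_zero (hage.symm.trans hk), h0]
  obtain ⟨s, hs, h₁, h₂, h₃⟩ := exists_last_update hk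
  obtain ⟨s', hs', h₁', h₂', h₃'⟩ := exists_last_update (hage.symm.trans hk)
  have hc : η x s = η' x s' := ih s hs x s' hx (h₂.trans h₂'.symm)
  obtain ⟨hy, hr⟩ := hη.effAge_right rfl hx h₁
  have hr' := (hη'.effAge_right rfl hx' h₁').2
  have hright : η (x + 1) s = η' (x + 1) s' := ih s hs _ _ hy (by
    rw [hr, hr', h₂, h₂', h0, h0])
  have hleft : (η (x - 1) s).2.cmd = (η' (x - 1) s').2.cmd := by
    by_cases hw : (η (x - 1) 0).2.stamp = none
    · obtain ⟨i, w, h⟩ := State.exists_eq_of_stamp_eq_none ((hη.stamp_eq_none_iff _ s).2 hw)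
      obtain ⟨i', w', h'⟩ := State.exists_eq_of_stamp_eq_none
        ((hη'.stamp_eq_none_iff _ s').2 (h0 (x - 1) ▸ hw))
      rw [h, h']; rfl
    · rw [ih s hs _ s' hw]
      have := hη.effAge_left (by omega : x = x - 1 + 1) hw hx h₁
      have := hη'.effAge_left (by omega : x = x - 1 + 1) (h0 (x - 1) ▸ hw) hx' h₁'
      rw [← h0, ← h0] at this
      omega
  obtain ⟨i, p, d, hxs⟩ := State.exists_eq_of_stamp_ne_none
    (fun h => hx ((hη.stamp_eq_none_iff x s).1 h))
  rw [h₃, h₃', (hη.cell_update h₁ hxs).2, (hη'.cell_update h₁' (hc.symm.trans hxs)).2, hright,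
    hleft]

theorem InputMachine.nextDatum_ne_start (c : Cmd Γ) (d : Datum Γ Λ) (t : Γ × Γ) (z : Bool) :
    I.nextDatum c d t z ≠ .start := by
  intro h
  cases c <;> cases d <;> cases z <;> simp only [InputMachine.nextDatum, reduceCtorEq] at h <;>
    split at h <;> cases h

theorem InputMachine.nextDatum_reset (d : Datum Γ Λ) (t : Γ × Γ) (z : Bool) :
    I.nextDatum .reset d t z = .mem .reset default default := by
  cases d <;> rfl

theorem InputMachine.nextDatum_mem (c c' : Cmd Γ) (l r : Γ) (t : Γ × Γ) :
    ∃ c₁ l₁ r₁, ∀ z, I.nextDatum c (.mem c' l r) t z = .mem c₁ l₁ r₁ := by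
  cases c <;> exact ⟨_, _, _, fun _ => rfl⟩

theorem InputMachine.row_succ_zero (h : ℕ) :
    I.row e (h + 1) 0 = I.next .noop (I.row e h 0) (I.row e h 1).2.tops := by
  rw [InputMachine.row]

theorem InputMachine.row_succ_succ (h j : ℕ) :
    I.row e (h + 1) (j + 1) = I.next (I.row e (h + 1) j).2.cmd (I.row e h (j + 1))
      (I.row e h (j + 2)).2.tops := by
  rw [InputMachine.row]

theorem InputMachine.row_one_zero : I.row e 1 0 = (Fin.last e, .pre .reset) := by
  rw [I.row_succ_zero, InputMachine.row]; rfl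

theorem InputMachine.row_one_cmd (j : ℕ) : (I.row e 1 j).2.cmd = .reset := by
  induction j with
  | zero => rw [I.row_one_zero]; rfl
  | succ j ih => rw [I.row_succ_succ, ih, InputMachine.next, I.nextDatum_reset]; rfl

theorem InputMachine.row_one_succ (j : ℕ) :
    (I.row e 1 (j + 1)).2 = .mem .reset default default := by
  rw [I.row_succ_succ, I.row_one_cmd, InputMachine.next, I.nextDatum_reset]

theorem InputMachine.row_mem (h j : ℕ) : ∃ c l r, (I.row e h (j + 1)).2 = .mem c l r := by
  induction h with
  | zero => exact ⟨_, _, _, by rw [InputMachine.row]⟩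
  | succ h ih =>
    obtain ⟨c, l, r, hm⟩ := ih
    obtain ⟨c₁, l₁, r₁, h₁⟩ := I.nextDatum_mem (I.row e (h + 1) j).2.cmd c l r
      (I.row e h (j + 2)).2.tops
    exact ⟨c₁, l₁, r₁, by rw [I.row_succ_succ, InputMachine.next, hm, h₁]⟩

/-- To the right of a wall, a cell in state `start` runs the ideal history. -/
theorem IsAsyncTraj.eq_row {η : ℤ → ℕ → State e Γ Λ} (hη : IsAsyncTraj (caF (I.rule e)) η)
    {y : ℤ} (hw : (η (y - 1) 0).2.stamp = none) {i₀ : Fin (e + 1)} {p₀ : Bool}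
    (hy : η y 0 = (i₀, .inr (p₀, .start))) (s : ℕ) :
    ∀ j h : ℕ, (∀ i ≤ j, (η (y + (i : ℕ)) 0).2.stamp ≠ none) →
      effAge η (y + j) s = ageOffset (fun x => η x 0) y j + h + 1 →
      ∃ k p, η (y + j) s = (k, .inr (p, (I.row e (h + 1) j).2)) ∧
        (j = 0 → k = (I.row e (h + 1) 0).1) := by
  induction s with
  | zero => intro j h _ ha; simp [effAge_zero] at ha
  | succ s ih =>
    intro j h hj ha
    by_cases hc : η (y + j) (s + 1) = η (y + j) s
    · rw [effAge_succ_of_eq hc] at ha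
      rw [hc]; exact ih j h hj ha
    rw [effAge_succ_of_ne hc, add_left_inj] at ha
    obtain ⟨i, p, d, hx⟩ := State.exists_eq_of_stamp_ne_none
      (fun h => hj j le_rfl ((hη.stamp_eq_none_iff _ s).1 h))
    have hu := (hη.cell_update hc hx).2
    obtain ⟨hrw, hra⟩ := hη.effAge_right rfl (hj j le_rfl) hc
    have hleft : (η (y + j - 1) s).2.cmd =
        match (generalizing := false) j with | 0 => .noop | j + 1 => (I.row e (h + 1) j).2.cmd := by
      cases j with
      | zero =>
        obtain ⟨k, w, hk⟩ := State.exists_eq_of_stamp_eq_none ((hη.stamp_eq_none_iff _ s).2 hw)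
        rw [show y + ((0 : ℕ) : ℤ) - 1 = y - 1 by simp, hk]; rfl
      | succ j =>
        have hle := hη.effAge_left (x := y + j) (by push_cast; ring) (hj j (by omega))
          (hj (j + 1) le_rfl) hc
        obtain ⟨k, q, hk, -⟩ := ih j h (fun i hi => hj i (by omega)) (by
          rw [ha, ageOffset_succ] at hle
          simp only [Nat.cast_add, Nat.cast_one, ← add_assoc] at hle
          omega)
        rw [show y + ((j + 1 : ℕ) : ℤ) - 1 = y + j by push_cast; ring, hk]; rfl
    rw [hleft] at hu
    cases h with
    | zero =>
      cases j with
      | zero =>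
        have h0 : η (y + (0 : ℕ)) s = η y 0 := by
          have := eq_zero_of_effAge_eq_zero (ha.trans (by simp [ageOffset]))
          rw [this]; simp
        rw [h0, hy] at hx
        cases hx
        rw [hu, I.row_one_zero]
        exact ⟨_, _, rfl, fun _ => rfl⟩
      | succ j =>
        simp only [Nat.zero_add, I.row_one_cmd] at hu
        rw [hu, I.row_one_succ, InputMachine.next, I.nextDatum_reset]
        exact ⟨_, _, rfl, fun h => absurd h (by omega)⟩
    | succ h =>
      obtain ⟨k, q, hk, hk0⟩ := ih j h hj ha
      rw [hx] at hk
      cases hk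
      have hright : (η (y + j + 1) s).2.tops = (I.row e (h + 1) (j + 1)).2.tops := by
        obtain ⟨k, q, hk, -⟩ := ih (j + 1) h (fun i' hi => by
            rcases Nat.lt_or_ge j i' with h | h
            · rw [show i' = j + 1 by omega]; push_cast; rwa [← add_assoc]
            · exact hj i' h) (by
          rw [ageOffset_succ]
          push_cast; rw [← add_assoc]
          omega)
        push_cast at hk
        rw [← add_assoc] at hk
        rw [hk]; rfl
      rw [hright] at hu
      cases j with
      | zero =>
        refine ⟨(I.row e (h + 2) 0).1, !p, hu.trans ?_, fun _ => rfl⟩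
        rw [I.row_succ_zero (h + 1), hk0 rfl]
      | succ j =>
        refine ⟨_, !p, hu.trans (Prod.ext rfl ?_), fun h => absurd h (by omega)⟩
        obtain ⟨c, l, r, hm⟩ := I.row_mem (e := e) (h + 1) j
        obtain ⟨c₁, l₁, r₁, h₁⟩ := I.nextDatum_mem (I.row e (h + 1 + 1) j).2.cmd c l r
          (I.row e (h + 1) (j + 2)).2.tops
        rw [I.row_succ_succ (h + 1) j]
        simp only [InputMachine.next, hm, h₁]

theorem IsAsyncTraj.start_of_start {η : ℤ → ℕ → State e Γ Λ}
    (hη : IsAsyncTraj (caF (I.rule e)) η) {y : ℤ} {s : ℕ} {i : Fin (e + 1)} {p : Bool}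
    (h : η y s = (i, .inr (p, .start))) : η y 0 = (i, .inr (p, .start)) := by
  induction s with
  | zero => exact h
  | succ s ih =>
    by_cases hc : η y (s + 1) = η y s
    · exact ih (hc.symm.trans h)
    rcases hy : η y s with ⟨k, w | ⟨q, d⟩⟩
    · rw [(hη.wall_update hc hy).2] at h; cases h
    · rw [(hη.cell_update hc hy).2] at h
      simp only [Prod.mk.injEq, Sum.inr.injEq] at h
      exact absurd h.2.2 (I.nextDatum_ne_start _ _ _ _)

theorem InputMachine.invariantHistories (hI : ∀ h, (I.row e h 0).2 ≠ .halt) :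
    InvariantHistories (caF (I.rule e)) := by
  rw [invariantHistories_iff]
  intro η η' hη hη' h0 x t t' hage
  by_cases hx : (η x 0).2.stamp = none
  swap
  · exact hη.cell_eq hη' h0 t x t' hx hage
  have key : ∀ η : ℤ → ℕ → State e Γ Λ, IsAsyncTraj (caF (I.rule e)) η →
      (η x 0).2.stamp = none → ∀ t, η x t = η x 0 ∨ ∃ i s, η x 0 = (i, .inl none) ∧
        η x t = (i, .inl (wallStep (η (x + 1) s).2)) ∧ wallStep (η (x + 1) s).2 ≠ none := by
    intro η hη hx t
    induction t with
    | zero => exact .inl rfl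
    | succ t ih =>
      by_cases hc : η x (t + 1) = η x t
      · rwa [hc]
      obtain ⟨i, w, hi⟩ := State.exists_eq_of_stamp_eq_none ((hη.stamp_eq_none_iff x t).2 hx)
      obtain ⟨rfl, h₂⟩ := hη.wall_update hc hi
      rcases ih with ih | ⟨i', s, h₁', h₂', h₃'⟩
      · refine .inr ⟨i, t, ih.symm.trans hi, h₂, fun h => hc ?_⟩
        rw [h₂, hi, h]
      · rw [hi] at h₂'
        simp only [Prod.mk.injEq, Sum.inl.injEq] at h₂'
        exact absurd h₂'.2.symm h₃'
  have zero : ∀ η : ℤ → ℕ → State e Γ Λ, IsAsyncTraj (caF (I.rule e)) η →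
      ∀ t, effAge η x t ≠ 0 → (η x 0).2.stamp = none → η x t ≠ η x 0 := by
    intro η hη t ha hx hxt
    obtain ⟨k, hk⟩ := Nat.exists_eq_succ_of_ne_zero ha
    obtain ⟨s, hs, h₁, h₂, h₃⟩ := exists_last_update hk
    obtain ⟨i, w, hi⟩ := State.exists_eq_of_stamp_eq_none ((hη.stamp_eq_none_iff x s).2 hx)
    obtain ⟨rfl, h₄⟩ := hη.wall_update h₁ hi
    rcases key η hη hx s with h | ⟨i', s', -, h, h'⟩
    · exact h₁ (h₃.symm.trans (hxt.trans h.symm))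
    · rw [hi] at h
      simp only [Prod.mk.injEq, Sum.inl.injEq] at h
      exact h' h.2.symm
  have clash : ∀ η η' : ℤ → ℕ → State e Γ Λ, IsAsyncTraj (caF (I.rule e)) η →
      IsAsyncTraj (caF (I.rule e)) η' → (∀ x, η x 0 = η' x 0) → (η x 0).2.stamp = none →
      ∀ s s', wallStep (η (x + 1) s).2 = some false → wallStep (η' (x + 1) s').2 ≠ some true := by
    intro η η' hη hη' h0 hx s s' hs hs'
    obtain ⟨i, hi⟩ : ∃ i p, η (x + 1) s = (i, .inr (p, .start)) := by
      rcases h : η (x + 1) s with ⟨i, w | ⟨p, d⟩⟩ <;> rw [h] at hs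
      · cases hs
      · cases d <;> first | cases hs; done | exact ⟨_, _, rfl⟩
    obtain ⟨p, hi⟩ := hi
    obtain ⟨i', p', hi'⟩ : ∃ i p, η' (x + 1) s' = (i, .inr (p, .halt)) := by
      rcases h : η' (x + 1) s' with ⟨i, w | ⟨p, d⟩⟩ <;> rw [h] at hs'
      · cases hs'
      · cases d <;> first | cases hs'; done | exact ⟨_, _, rfl⟩
    have hst := hη.start_of_start hi
    rw [h0] at hst
    rcases ha : effAge η' (x + 1) s' with _ | k
    · rw [eq_zero_of_effAge_eq_zero ha, hst] at hi'
      cases hi'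
    · obtain ⟨k', q, hk, -⟩ := hη'.eq_row (y := x + 1) (by simpa [← h0] using hx) hst s' 0 k
        (fun i hi => by
          rw [Nat.le_zero.1 hi]; simp [hst, Control.stamp]) (by simpa [ageOffset] using ha)
      simp only [Nat.cast_zero, add_zero] at hk
      rw [hi'] at hk
      simp only [Prod.mk.injEq, Sum.inr.injEq] at hk
      exact hI _ hk.2.2.symm
  have hx' : (η' x 0).2.stamp = none := h0 x ▸ hx
  by_cases ha : effAge η x t = 0
  · rw [eq_zero_of_effAge_eq_zero ha, eq_zero_of_effAge_eq_zero (hage.symm.trans ha), h0]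
  have n₁ := zero η hη t ha hx
  have n₂ := zero η' hη' t' (hage ▸ ha) hx'
  obtain ⟨i, s, h₁, h₂, h₃⟩ := (key η hη hx t).resolve_left n₁
  obtain ⟨i', s', h₁', h₂', h₃'⟩ := (key η' hη' hx' t').resolve_left n₂
  rw [h0, h₁'] at h₁
  cases h₁
  rw [h₂, h₂']
  have c₁ := clash η η' hη hη' h0 hx s s'
  have c₂ := clash η' η hη' hη (fun x => (h0 x).symm) hx' s' s
  rcases hw : wallStep (η (x + 1) s).2 with _ | _ | _ <;>
    rcases hw' : wallStep (η' (x + 1) s').2 with _ | _ | _ <;> simp_all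

theorem effAge_eq_one_of_switch {C S : Type*} {η : C → ℕ → S} {x : C} {a b : S} (hab : a ≠ b)
    {T : ℕ} (h : ∀ s, η x s = if s ≤ T then a else b) : effAge η x (T + 1) = 1 := by
  have h0 : ∀ s ≤ T, effAge η x s = 0 := by
    intro s
    induction s with
    | zero => intro; exact effAge_zero _ _
    | succ s ih =>
      intro hs
      rw [effAge_succ_of_eq, ih (by omega)]
      rw [h, h, if_pos hs, if_pos (by omega)]
  rw [effAge_succ_of_ne, h0 T le_rfl]
  rw [h, h, if_pos le_rfl, if_neg (by omega)]
  exact hab.symm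

theorem InputMachine.not_invariantHistories {H : ℕ} (hH : (I.row e H 0).2 = .halt) :
    ¬ InvariantHistories (caF (I.rule e)) := by
  rw [invariantHistories_iff]
  intro hI
  let cell : ℕ → ℕ → State e Γ Λ := fun h j =>
    ((I.row e h j).1, .inr (decide (h % 2 = 1), (I.row e h j).2))
  let wall : Option Bool → State e Γ Λ := fun w => (0, .inl w)
  let η : ℤ → ℕ → State e Γ Λ := fun x s =>
    if 0 ≤ x then cell ((s + 1 - x.toNat) / 2) x.toNat
    else if x = -1 then (if s ≤ 2 * H then wall none else wall (some true))
    else wall (some false)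
  let η' : ℤ → ℕ → State e Γ Λ := fun x s =>
    if x = -1 then (if s ≤ 0 then wall none else wall (some false)) else η x 0
  have hcell : ∀ (j s : ℕ), η j s = cell ((s + 1 - j) / 2) j := fun j s => by simp [η]
  have hwall : ∀ s, η (-1) s = if s ≤ 2 * H then wall none else wall (some true) := fun s => by
    simp [η]
  have hwall' : ∀ s, η' (-1) s = if s ≤ 0 then wall none else wall (some false) := fun s => by
    simp [η']
  have hη : IsAsyncTraj (caF (I.rule e)) η := by
    intro x s hne
    rcases lt_or_ge x 0 with hx | hx
    · rcases eq_or_ne x (-1) with rfl | hx1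
      · have hs : s = 2 * H := by
          rw [hwall, hwall] at hne
          by_contra hs
          rcases Nat.lt_or_ge (2 * H) s with h | h
          · rw [if_neg (by omega), if_neg (by omega)] at hne; exact hne rfl
          · rw [if_pos (by omega), if_pos h] at hne; exact hne rfl
        subst hs
        have h0 := hcell 0 (2 * H)
        rw [show (2 * H + 1 - 0) / 2 = H by omega] at h0
        simp only [caF, hwall]
        rw [if_neg (by omega), if_pos le_rfl, rule_wall, show (-1 : ℤ) + 1 = ((0 : ℕ) : ℤ) by simp,
          h0]
        simp only [cell, hH, wallStep, wall]
      · simp [η, hx.not_ge, hx1] at hne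
    · obtain ⟨j, rfl⟩ := Int.eq_ofNat_of_zero_le hx
      obtain ⟨h, hs⟩ : ∃ h, s = j + 2 * h := by
        rw [hcell, hcell] at hne
        by_contra hs
        refine hne (congrArg (fun h => cell h j) ?_)
        by_contra hh
        exact hs ⟨(s - j) / 2, by omega⟩
      have hr : η ((j : ℤ) + 1) s = cell ((s - j) / 2) (j + 1) := by
        simpa using hcell (j + 1) s
      simp only [caF, hcell, hr]
      rw [show (s + 1 - j) / 2 = h by omega, show (s + 1 + 1 - j) / 2 = h + 1 by omega,
        show (s - j) / 2 = h by omega]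
      have hp : (!decide (h % 2 = 1)) = decide ((h + 1) % 2 = 1) := by
        rcases Nat.mod_two_eq_zero_or_one h with h' | h' <;> simp [h', Nat.add_mod]
      cases j with
      | zero =>
        have hw : ∃ w, η (((0 : ℕ) : ℤ) - 1) s = wall w := by
          simp only [Nat.cast_zero, zero_sub, hwall]
          split_ifs <;> exact ⟨_, rfl⟩
        obtain ⟨w, hw⟩ := hw
        rw [hw]
        refine Eq.trans ?_ (rule_cell_of_active _ _ ⟨by simp [wall, Control.stamp], rfl⟩).symm
        simp only [cell, hp, I.row_succ_zero]
        rfl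
      | succ j =>
        rw [show ((j + 1 : ℕ) : ℤ) - 1 = j by push_cast; ring, hcell,
          show (s + 1 - j) / 2 = h + 1 by omega]
        refine Eq.trans ?_ (rule_cell_of_active _ _ ⟨?_, rfl⟩).symm
        · simp only [cell, hp, I.row_succ_succ]
          rfl
        · simp only [cell, Control.stamp, ← hp, ne_eq, Option.some.injEq]
          cases decide (h % 2 = 1) <;> simp
  have hη' : IsAsyncTraj (caF (I.rule e)) η' := by
    intro x s hne
    rcases eq_or_ne x (-1) with rfl | hx
    · have hs : s = 0 := by
        by_contra hs
        rw [hwall', hwall', if_neg (by omega), if_neg (by omega)] at hne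
        exact hne rfl
      subst hs
      have h0 : η' (-1 + 1) 0 = cell 0 0 := by simp [η', η]
      simp only [caF, hwall', h0]
      rw [if_neg (by omega), if_pos le_rfl, rule_wall]
      simp only [cell, InputMachine.row, wallStep, wall]
    · simp [η', hx] at hne
  have h := hI η η' hη hη' (fun x => by simp only [η', η]; split_ifs <;> simp_all) (-1)
    (2 * H + 1) (0 + 1) (by
      rw [effAge_eq_one_of_switch _ hwall, effAge_eq_one_of_switch _ hwall'] <;> simp [wall])
  rw [hwall, hwall', if_neg (by omega), if_neg (by omega)] at h
  simp [wall] at h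

/-- In row `h`, the stacks hold the symbols `L` and `R`. -/
def InputMachine.Stacks (I : InputMachine Γ Λ) (e h : ℕ) (L R : ℕ → Γ) : Prop :=
  ∀ j, ∃ c, (I.row e h (j + 1)).2 = .mem c (L j) (R j)

theorem InputMachine.Stacks.noop {h : ℕ} {L R : ℕ → Γ} (hs : I.Stacks e h L R)
    (hc : (I.row e (h + 1) 0).2.cmd = .noop) : I.Stacks e (h + 1) L R := by
  have : ∀ j, (I.row e (h + 1) (j + 1)).2 = .mem .noop (L j) (R j) := by
    intro j
    induction j with
    | zero =>
      obtain ⟨c, hj⟩ := hs 0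
      rw [I.row_succ_succ, InputMachine.next, hj, hc]; rfl
    | succ j ih =>
      obtain ⟨c, hj⟩ := hs (j + 1)
      rw [I.row_succ_succ, InputMachine.next, hj, ih]; rfl
  exact fun j => ⟨_, this j⟩

theorem InputMachine.Stacks.right {h : ℕ} {L R L' : ℕ → Γ} (hs : I.Stacks e h L R)
    (hc : (I.row e (h + 1) 0).2.cmd = .right (L' 0)) (hL : ∀ j, L' (j + 1) = L j) :
    I.Stacks e (h + 1) L' fun j => R (j + 1) := by
  have : ∀ j, (I.row e (h + 1) (j + 1)).2 = .mem (.right (L j)) (L' j) (R (j + 1)) := by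
    intro j
    induction j with
    | zero =>
      obtain ⟨c, hj⟩ := hs 0
      obtain ⟨c', hj'⟩ := hs 1
      rw [I.row_succ_succ, InputMachine.next, hj, hj', hc]; rfl
    | succ j ih =>
      obtain ⟨c, hj⟩ := hs (j + 1)
      obtain ⟨c', hj'⟩ := hs (j + 2)
      rw [I.row_succ_succ, InputMachine.next, hj, hj', ih, hL]; rfl
  exact fun j => ⟨_, this j⟩

theorem InputMachine.Stacks.left {h : ℕ} {L R R' : ℕ → Γ} (hs : I.Stacks e h L R)
    (hc : (I.row e (h + 1) 0).2.cmd = .left (R' 0)) (hR : ∀ j, R' (j + 1) = R j) :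
    I.Stacks e (h + 1) (fun j => L (j + 1)) R' := by
  have : ∀ j, (I.row e (h + 1) (j + 1)).2 = .mem (.left (R j)) (L (j + 1)) (R' j) := by
    intro j
    induction j with
    | zero =>
      obtain ⟨c, hj⟩ := hs 0
      obtain ⟨c', hj'⟩ := hs 1
      rw [I.row_succ_succ, InputMachine.next, hj, hj', hc]; rfl
    | succ j ih =>
      obtain ⟨c, hj⟩ := hs (j + 1)
      obtain ⟨c', hj'⟩ := hs (j + 2)
      rw [I.row_succ_succ, InputMachine.next, hj, hj', ih, hR]; rfl
  exact fun j => ⟨_, this j⟩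

/-- Row `h` represents a configuration of the machine. -/
def InputMachine.Represents (I : InputMachine Γ Λ) (e h : ℕ) (C : TM0.Cfg Γ Λ) : Prop :=
  (∃ c, (I.row e h 0).2 = .run C.q C.Tape.head c) ∧
    I.Stacks e h C.Tape.left.nth C.Tape.right.nth

theorem InputMachine.Represents.halt {h : ℕ} {C : TM0.Cfg Γ Λ} (hC : I.Represents e h C)
    (hs : TM0.step I.M C = none) : (I.row e (h + 1) 0).2 = .halt := by
  obtain ⟨⟨c, h₀⟩, -⟩ := hC
  obtain ⟨q, T⟩ := C
  have hM : I.M q T.head = none := by simpa [TM0.step] using hs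
  rw [I.row_succ_zero, InputMachine.next, h₀]
  simp only [InputMachine.nextDatum, hM]

theorem InputMachine.Represents.step {h : ℕ} {C C' : TM0.Cfg Γ Λ} (hC : I.Represents e h C)
    (hs : TM0.step I.M C = some C') : I.Represents e (h + 1) C' := by
  obtain ⟨⟨c, h₀⟩, hst⟩ := hC
  obtain ⟨q, T⟩ := C
  obtain ⟨c₁, h₁⟩ := hst 0
  have hr : (I.row e (h + 1) 0).2 = I.nextDatum .noop (.run q T.head c)
      (T.left.nth 0, T.right.nth 0) (decide ((I.row e h 0).1 = 0)) := by
    rw [I.row_succ_zero, InputMachine.next, h₀, h₁]; rfl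
  simp only [TM0.step, Option.map_eq_some_iff] at hs
  obtain ⟨⟨q', s⟩, hM, rfl⟩ := hs
  change I.M q T.head = _ at hM
  rcases s with (_ | _) | c'
  · simp only [InputMachine.nextDatum, hM, ListBlank.nth_zero] at hr
    refine ⟨⟨_, hr⟩, ?_⟩
    have := hst.left (R' := (T.right.cons T.head).nth) (by rw [hr]; simp [Datum.cmd])
      (fun j => by simp [ListBlank.nth_succ])
    simpa only [Tape.move, ListBlank.nth_succ] using this
  · simp only [InputMachine.nextDatum, hM, ListBlank.nth_zero] at hr
    refine ⟨⟨_, hr⟩, ?_⟩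
    have := hst.right (L' := (T.left.cons T.head).nth) (by rw [hr]; simp [Datum.cmd])
      (fun j => by simp [ListBlank.nth_succ])
    simpa only [Tape.move, ListBlank.nth_succ] using this
  · simp only [InputMachine.nextDatum, hM] at hr
    exact ⟨⟨_, by rw [hr]; rfl⟩, hst.noop (by rw [hr]; rfl)⟩

theorem InputMachine.row_pre {k : ℕ} (hk : k ≤ e) :
    (∃ c, I.row e (k + 1) 0 = (⟨e - k, by omega⟩, .pre c)) ∧
      I.Stacks e (k + 1) (fun _ => default) (List.replicate k I.z).getI := by
  induction k with
  | zero =>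
    exact ⟨⟨_, I.row_one_zero⟩, fun j => ⟨.reset, by rw [I.row_one_succ]; simp [List.getI]⟩⟩
  | succ k ih =>
    obtain ⟨⟨c, h₀⟩, hs⟩ := ih (by omega)
    have h₁ : I.row e (k + 1 + 1) 0 = (⟨e - (k + 1), by omega⟩, .pre (.left I.z)) := by
      have hz : decide ((⟨e - k, by omega⟩ : Fin (e + 1)) = 0) = false := by
        simp only [decide_eq_false_iff_not, Fin.ext_iff, Fin.val_zero]; omega
      rw [I.row_succ_zero, h₀]
      simp only [InputMachine.next, hz]
      rfl
    refine ⟨⟨_, h₁⟩, hs.left (by rw [h₁]; rfl) fun j => ?_⟩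
    rw [List.replicate_succ, List.getI_cons_succ]

theorem InputMachine.represents_init :
    I.Represents e (e + 2) (TM0.init (I.a :: I.b :: List.replicate e I.z)) := by
  obtain ⟨⟨c, h₀⟩, hs⟩ := I.row_pre (le_refl e)
  have h₁ : (I.row e (e + 1 + 1) 0).2 = .run default I.a (.left I.b) := by
    have hz : decide ((⟨e - e, by omega⟩ : Fin (e + 1)) = 0) = true := by
      simp
    rw [I.row_succ_zero, h₀]
    simp only [InputMachine.next, hz]
    rfl
  refine ⟨⟨_, h₁⟩, ?_⟩
  have := hs.left (R' := (I.b :: List.replicate e I.z).getI) (by rw [h₁]; rfl) fun j => by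
    rw [List.getI_cons_succ]
  intro j
  obtain ⟨c, hc⟩ := this j
  refine ⟨c, hc.trans ?_⟩
  have hl : (default : Γ) = (TM0.init (Λ := Λ) (I.a :: I.b :: List.replicate e I.z)).Tape.left.nth j
      := by
    change _ = (ListBlank.mk []).nth j
    simp
  rw [← hl]; rfl

/-- The ideal history halts if and only if the machine does. -/
theorem InputMachine.exists_row_halt_iff :
    (∃ h, (I.row e h 0).2 = .halt) ↔
      (TM0.eval I.M (I.a :: I.b :: List.replicate e I.z)).Dom := by
  change _ ↔ (StateTransition.eval (TM0.step I.M)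
    (TM0.init (I.a :: I.b :: List.replicate e I.z))).Dom
  rw [Part.dom_iff_mem]
  simp only [StateTransition.mem_eval]
  constructor
  · rintro ⟨h, hh⟩
    by_contra! hne
    have key : ∀ n, ∃ C, StateTransition.Reaches (TM0.step I.M)
        (TM0.init (I.a :: I.b :: List.replicate e I.z)) C ∧ I.Represents e (e + 2 + n) C := by
      intro n
      induction n with
      | zero => exact ⟨_, .refl, I.represents_init⟩
      | succ n ih =>
        obtain ⟨C, hr, hC⟩ := ih
        obtain ⟨C', hC'⟩ := Option.ne_none_iff_exists'.1 (hne C hr)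
        exact ⟨C', hr.tail hC', hC.step hC'⟩
    rcases Nat.lt_or_ge h (e + 2) with hlt | hge
    · cases h with
      | zero => rw [InputMachine.row] at hh; cases hh
      | succ h =>
        obtain ⟨⟨c, hc⟩, -⟩ := I.row_pre (e := e) (k := h) (by omega)
        rw [hc] at hh; cases hh
    · obtain ⟨C, -, ⟨c, hc⟩, -⟩ := key (h - (e + 2))
      rw [show e + 2 + (h - (e + 2)) = h by omega, hh] at hc
      cases hc
  · rintro ⟨C, hr, hC⟩
    have : ∃ h, I.Represents e h C := by
      clear hC
      induction hr with
      | refl => exact ⟨_, I.represents_init⟩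
      | tail _ hs ih =>
        obtain ⟨h, hh⟩ := ih
        exact ⟨_, hh.step hs⟩
    obtain ⟨h, hh⟩ := this
    exact ⟨_, hh.halt hC⟩

/-- The automaton has invariant histories if and only if the machine does not halt. -/
theorem InputMachine.invariantHistories_iff :
    InvariantHistories (caF (I.rule e)) ↔
      ¬ (TM0.eval I.M (I.a :: I.b :: List.replicate e I.z)).Dom := by
  rw [← I.exists_row_halt_iff]
  exact ⟨fun h ⟨_, hh⟩ => I.not_invariantHistories hh h,
    fun h => I.invariantHistories fun k hk => h ⟨k, hk⟩⟩

end Machine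

theorem exists_counterRule {p : ℕ → Prop} (hp : REPred p) :
    ∃ (N : ℕ) (A : Fin (N + 1) → Fin (N + 1) → Fin (N + 1) → Option Bool)
      (T : Fin (N + 1) → Fin (N + 1) → Fin (N + 1) → Bool → Fin (N + 1)),
      ∀ e, InvariantHistories (caF (counterRule e A T)) ↔ ¬ p e := by
  obtain ⟨Γ, Λ, _, _, _, _, M, a, b, z, h⟩ := exists_tm0 hp
  let I : InputMachine Γ Λ := ⟨M, a, b, z⟩
  obtain ⟨m, ⟨φ⟩⟩ := Finite.exists_equiv_fin (Control Γ Λ)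
  obtain ⟨N, rfl⟩ : ∃ N, m = N + 1 := Nat.exists_eq_succ_of_ne_zero <| by
    rintro rfl
    exact (φ (.inl none)).elim0
  refine ⟨N, fun l c r => counterControl (φ.symm l) (φ.symm c) (φ.symm r),
    fun l c r w => φ (I.control (φ.symm l) (φ.symm c) (φ.symm r) w), fun e => ?_⟩
  rw [← h e, ← InputMachine.invariantHistories_iff (I := I) (e := e)]
  refine invariantHistories_congr ((Equiv.refl (Fin (e + 1))).prodCongr φ) ?_
  rintro ⟨i, l⟩ ⟨j, c⟩ ⟨k, r⟩
  simp [InputMachine.rule, counterRule]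

theorem computable_sum_range {α : Type*} [Primcodable α] {f : α → ℕ → ℕ} {b : α → ℕ}
    (hf : Computable₂ f) (hb : Computable b) :
    Computable fun a => ∑ i ∈ Finset.range (b a), f a i := by
  refine (Computable.nat_rec (h := fun a (p : ℕ × ℕ) => p.2 + f a p.1) hb (Computable.const 0)
    ?_).of_eq fun a => ?_
  · exact (Primrec.nat_add.to_comp.comp (Computable.snd.comp Computable.snd)
      (hf.comp Computable.fst (Computable.fst.comp Computable.snd))).to₂
  · induction b a with
    | zero => rfl
    | succ n ih => rw [Finset.sum_range_succ, ← ih]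

theorem rePred_exists_nat {α : Type*} [Primcodable α] {R : α → ℕ → Prop}
    (hR : ComputablePred fun x : α × ℕ => R x.1 x.2) : REPred fun a => ∃ k, R a k := by
  classical
  have h : Partrec fun a => Nat.rfind fun k => Part.some (decide (R a k)) :=
    Partrec.rfind hR.decide.partrec
  exact h.dom_re.of_eq fun a => Nat.rfind_dom.trans (by simp)

theorem exists_code_evaln {p : ℕ → Prop} (hp : REPred p) :
    ∃ c : Nat.Partrec.Code, ∀ n, p n ↔ ∃ k, (c.evaln k n).isSome := by
  have hp' : Nat.Partrec _ := hp
  obtain ⟨c, hc⟩ := Nat.Partrec.Code.exists_code.1 hp'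
  refine ⟨c, fun n => ?_⟩
  have : p n ↔ (c.eval n).Dom := by
    rw [hc]; simp [Part.assert]
  rw [this, Part.dom_iff_mem]
  simp only [Nat.Partrec.Code.evaln_complete, Option.isSome_iff_exists, Option.mem_def]
  exact exists_comm

/-- If the complement of `P` is enumerable and the number of `r < c n` satisfying `P n r` is
computable in `n`, then `P n r` is decidable for `r < c n`. -/
theorem exists_computable_of_card {P : ℕ → ℕ → Prop} {c N : ℕ → ℕ} (hc : Computable c)
    (hN : Computable N) (hre : REPred fun x => ¬ P (Nat.unpair x).1 (Nat.unpair x).2)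
    (hcard : ∀ n, Nat.card {r : Fin (c n) // P n r} = N n) :
    ∃ d : ℕ → ℕ → Bool, Computable₂ d ∧ ∀ n, ∀ r < c n, d n r = true ↔ P n r := by
  classical
  obtain ⟨C, hC⟩ := exists_code_evaln hre
  let u (M n r : ℕ) : Bool := (C.evaln M (Nat.pair n r)).isNone
  have hu : ∀ n r, ¬ P n r ↔ ∃ M, u M n r = false := fun n r => by
    simpa [u] using hC (Nat.pair n r)
  have humono : ∀ {M M' n r}, M ≤ M' → u M n r = false → u M' n r = false := by
    intro M M' n r hM h
    simp only [u, Option.isNone_eq_false_iff, Option.isSome_iff_exists] at h ⊢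
    exact h.imp fun _ => Nat.Partrec.Code.evaln_mono hM
  have huc : Primrec fun x : (ℕ × ℕ) × ℕ => u x.1.2 x.1.1 x.2 := by
    have := Nat.Partrec.Code.primrec_evaln.comp (((Primrec.snd.comp Primrec.fst).pair (Primrec.const C)).pair
      (Primrec₂.natPair.comp (Primrec.fst.comp Primrec.fst) Primrec.snd) :
      Primrec fun x : (ℕ × ℕ) × ℕ => ((x.1.2, C), Nat.pair x.1.1 x.2))
    exact (Primrec.not.comp (Primrec.option_isSome.comp this)).of_eq fun x => by simp [u]
  have hsum : ∀ n, N n = ∑ r ∈ Finset.range (c n), if P n r then 1 else 0 := fun n => by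
    rw [← hcard, Nat.card_eq_fintype_card, Fintype.card_subtype, Finset.card_filter,
      Fin.sum_univ_eq_sum_range (fun r => if P n r then 1 else 0)]
  have hle : ∀ M n r, (if P n r then 1 else 0) ≤ (u M n r).toNat := fun M n r => by
    split_ifs with h
    · by_contra h'
      exact (hu n r).2 ⟨M, by simpa using h'⟩ h
    · exact Nat.zero_le _
  have hiff : ∀ n M, ∑ r ∈ Finset.range (c n), (u M n r).toNat = N n ↔
      ∀ r < c n, (u M n r = true ↔ P n r) := fun n M => by
    rw [hsum, eq_comm, Finset.sum_eq_sum_iff_of_le fun r _ => hle M n r]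
    simp only [Finset.mem_range]
    refine forall₂_congr fun r _ => ?_
    by_cases h : P n r <;> cases u M n r <;> simp [h]
  have hex : ∀ n, ∃ M, ∑ r ∈ Finset.range (c n), (u M n r).toNat = N n := fun n => by
    simp only [hiff]
    have : ∀ r, ∃ M, ¬ P n r → u M n r = false := fun r => by
      by_cases h : P n r
      · exact ⟨0, fun h' => (h' h).elim⟩
      · exact ((hu n r).1 h).imp fun M hM _ => hM
    choose m hm using this
    refine ⟨(Finset.range (c n)).sup m, fun r hr => ⟨fun h => ?_, fun h => ?_⟩⟩
    · by_contra h'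
      rw [humono (Finset.le_sup (Finset.mem_range.2 hr)) (hm r h')] at h
      cases h
    · by_contra h'
      exact (hu n r).2 ⟨_, by simpa using h'⟩ h
  have hM : Computable fun n => Nat.find (hex n) := by
    refine Computable.find ?_ hex
    have h1 := computable_sum_range (α := ℕ × ℕ) (f := fun x r => (u x.2 x.1 r).toNat)
      ((Primrec.dom_bool Bool.toNat).comp huc).to_comp.to₂ (hc.comp Computable.fst)
    exact Computable.computablePred
      (Primrec.eq.decide.to_comp.comp h1 (hN.comp Computable.fst))
  refine ⟨fun n r => u (Nat.find (hex n)) n r, ?_, fun n r hr =>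
    (hiff n _).1 (Nat.find_spec (hex n)) r hr⟩
  exact huc.to_comp.comp ((Computable.fst.pair (hM.comp Computable.fst)).pair Computable.snd)

theorem computable_decode_elim {α : Type*} [Primcodable α] {f : α → ℕ} (hf : Computable f) :
    Computable fun x : ℕ => (Encodable.decode (α := α) x).elim 0 f :=
  (Computable.option_casesOn Computable.decode (Computable.const 0)
    (hf.comp Computable.snd).to₂).of_eq fun x => by cases Encodable.decode (α := α) x <;> rfl

theorem encode_rule (n : ℕ) (g : Fin n × Fin n × Fin n → Fin n) :
    @Encodable.encode (Σ n : ℕ, Fin n × Fin n × Fin n → Fin n) Primcodable.toEncodable ⟨n, g⟩ =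
      Nat.pair n (Fintype.equivFin _ g) :=
  rfl

theorem computable_card_rule {q : (Σ n : ℕ, Fin n × Fin n × Fin n → Fin n) → Prop}
    (h : ComputablePred q) :
    Computable fun n => Nat.card {g : Fin n × Fin n × Fin n → Fin n // q ⟨n, g⟩} := by
  classical
  have hD := computable_decode_elim ((Primrec.dom_bool Bool.toNat).to_comp.comp h.decide)
  have hc : Computable fun n : ℕ => n ^ (n * (n * n)) :=
    (primrec_nat_pow.comp .id (Primrec.nat_mul.comp .id (Primrec.nat_mul.comp .id .id))).to_comp
  refine (computable_sum_range (hD.comp Primrec₂.natPair.to_comp).to₂ hc).of_eq fun n => ?_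
  have hcard : Fintype.card (Fin n × Fin n × Fin n → Fin n) = n ^ (n * (n * n)) := by simp
  rw [Nat.card_eq_fintype_card, Fintype.card_subtype, Finset.card_filter, ← hcard,
    ← Fin.sum_univ_eq_sum_range, ← (Fintype.equivFin _).sum_comp]
  refine Finset.sum_congr rfl fun g _ => ?_
  dsimp only
  rw [← encode_rule, @Encodable.encodek _ Primcodable.toEncodable]
  by_cases hq : q ⟨n, g⟩ <;> simp [hq]

/-- The rule with state set `Fin n` whose table is given by the base `n` digits of `r`. -/
def digitRule (n r : ℕ) : Fin n × Fin n × Fin n → Fin n := fun s =>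
  ⟨r / n ^ (s.2.2 + n * s.2.1 + n * n * s.1 : ℕ) % n, Nat.mod_lt _ s.1.pos⟩

/-- Rules with state set `Fin n` are numbered by their tables of digits. -/
def ruleEquiv (n : ℕ) : (Fin n × Fin n × Fin n → Fin n) ≃ Fin (n ^ (n * (n * n))) :=
  (Equiv.arrowCongr (((Equiv.refl _).prodCongr finProdFinEquiv).trans finProdFinEquiv)
    (Equiv.refl _)).trans finFunctionFinEquiv

theorem ruleEquiv_symm_apply {n : ℕ} (r : Fin (n ^ (n * (n * n)))) :
    (ruleEquiv n).symm r = digitRule n r := by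
  funext ⟨a, b, c⟩
  ext
  simp [ruleEquiv, digitRule, Equiv.arrowCongr]

theorem digitRule_ruleEquiv {n : ℕ} (g : Fin n × Fin n × Fin n → Fin n) :
    digitRule n (ruleEquiv n g) = g := by
  rw [← ruleEquiv_symm_apply, Equiv.symm_apply_apply]

theorem ruleEquiv_apply {n : ℕ} (g : Fin n × Fin n × Fin n → Fin n) {G : ℕ → ℕ → ℕ → ℕ}
    (hG : ∀ a b c : Fin n, G a b c = g (a, b, c)) :
    (ruleEquiv n g : ℕ) =
      ∑ i ∈ Finset.range (n * (n * n)),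
        G (i / (n * n)) (i % (n * n) / n) (i % (n * n) % n) * n ^ i := by
  rw [ruleEquiv, Equiv.trans_apply, finFunctionFinEquiv_apply,
    ← Fin.sum_univ_eq_sum_range (fun i =>
      G (i / (n * n)) (i % (n * n) / n) (i % (n * n) % n) * n ^ i)]
  refine Finset.sum_congr rfl fun i _ => ?_
  congr 1
  rw [← Fin.coe_divNat, ← Fin.coe_modNat, ← Fin.coe_divNat, ← Fin.coe_modNat, hG]
  rfl

/-- `counterRule` on numbers, where `q + (N + 1) * i` stands for the state with counter `i` and
control part `q`. -/
def natCounterRule {N : ℕ} (A : Fin (N + 1) → Fin (N + 1) → Fin (N + 1) → Option Bool)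
    (T : Fin (N + 1) → Fin (N + 1) → Fin (N + 1) → Bool → Fin (N + 1)) (e a b c : ℕ) : ℕ :=
  let o := A (Fin.ofNat _ a) (Fin.ofNat _ b) (Fin.ofNat _ c)
  let i := b / (N + 1)
  T (Fin.ofNat _ a) (Fin.ofNat _ b) (Fin.ofNat _ c) (decide (i = 0)) +
    (N + 1) * if o = none then i else if o = some true then e else i - 1

theorem primrec_natCounterRule {N : ℕ}
    (A : Fin (N + 1) → Fin (N + 1) → Fin (N + 1) → Option Bool)
    (T : Fin (N + 1) → Fin (N + 1) → Fin (N + 1) → Bool → Fin (N + 1)) :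
    Primrec fun x : ℕ × ℕ × ℕ × ℕ => natCounterRule A T x.1 x.2.1 x.2.2.1 x.2.2.2 := by
  have hof : Primrec (Fin.ofNat (N + 1)) :=
    Primrec.fin_val_iff.1 (Primrec.nat_mod.comp .id (.const (N + 1)))
  have ha : Primrec fun x : ℕ × ℕ × ℕ × ℕ => Fin.ofNat (N + 1) x.2.1 :=
    hof.comp (Primrec.fst.comp .snd)
  have hb' : Primrec fun x : ℕ × ℕ × ℕ × ℕ => x.2.2.1 :=
    Primrec.fst.comp (Primrec.snd.comp .snd)
  have hb := hof.comp hb'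
  have hc : Primrec fun x : ℕ × ℕ × ℕ × ℕ => Fin.ofNat (N + 1) x.2.2.2 :=
    hof.comp (Primrec.snd.comp (Primrec.snd.comp .snd))
  have hi : Primrec fun x : ℕ × ℕ × ℕ × ℕ => x.2.2.1 / (N + 1) :=
    Primrec.nat_div.comp hb' (.const _)
  have hz : Primrec fun x : ℕ × ℕ × ℕ × ℕ => decide (x.2.2.1 / (N + 1) = 0) :=
    Primrec.eq.decide.comp hi (.const 0)
  have hA : Primrec fun x : ℕ × ℕ × ℕ × ℕ =>
      A (Fin.ofNat _ x.2.1) (Fin.ofNat _ x.2.2.1) (Fin.ofNat _ x.2.2.2) :=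
    (Primrec.dom_finite fun t : Fin (N + 1) × Fin (N + 1) × Fin (N + 1) =>
      A t.1 t.2.1 t.2.2).comp (ha.pair (hb.pair hc))
  have hT : Primrec fun x : ℕ × ℕ × ℕ × ℕ =>
      T (Fin.ofNat _ x.2.1) (Fin.ofNat _ x.2.2.1) (Fin.ofNat _ x.2.2.2)
        (decide (x.2.2.1 / (N + 1) = 0)) :=
    (Primrec.dom_finite fun t : Fin (N + 1) × Fin (N + 1) × Fin (N + 1) × Bool =>
      T t.1 t.2.1 t.2.2.1 t.2.2.2).comp (ha.pair (hb.pair (hc.pair hz)))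
  exact Primrec.nat_add.comp (Primrec.fin_val.comp hT) (Primrec.nat_mul.comp (.const _)
    (.ite (Primrec.eq.comp hA (.const _)) hi (.ite (Primrec.eq.comp hA (.const _)) .fst
      (Primrec.nat_sub.comp hi (.const 1)))))

theorem natCounterRule_eq {N e : ℕ}
    (A : Fin (N + 1) → Fin (N + 1) → Fin (N + 1) → Option Bool)
    (T : Fin (N + 1) → Fin (N + 1) → Fin (N + 1) → Bool → Fin (N + 1))
    (s : (Fin (e + 1) × Fin (N + 1)) × (Fin (e + 1) × Fin (N + 1)) × (Fin (e + 1) × Fin (N + 1))) :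
    natCounterRule A T e (finProdFinEquiv s.1) (finProdFinEquiv s.2.1) (finProdFinEquiv s.2.2) =
      finProdFinEquiv (counterRule e A T s) := by
  obtain ⟨⟨i, a⟩, ⟨j, b⟩, ⟨k, c⟩⟩ := s
  have hmod : ∀ (i : Fin (e + 1)) (q : Fin (N + 1)), Fin.ofNat (N + 1) (q + (N + 1) * i) = q := by
    intro i q
    ext
    simp [Nat.mod_eq_of_lt q.2]
  have hdiv : ((b + (N + 1) * j : ℕ)) / (N + 1) = j := by
    rw [Nat.add_mul_div_left _ _ N.succ_pos, Nat.div_eq_of_lt b.2, zero_add]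
  simp only [natCounterRule, finProdFinEquiv_apply_val, hmod, hdiv, counterRule]
  have hz : decide ((j : ℕ) = 0) = decide (j = 0) := decide_eq_decide.2 Fin.val_eq_zero_iff
  rw [hz]
  rcases A a b c with - | - | - <;> simp [counterStep]

/-- The complement of an enumerable predicate reduces to invariant histories. -/
theorem exists_digitRule {p : ℕ → Prop} (hp : REPred p) :
    ∃ n r : ℕ → ℕ, Computable n ∧ Computable r ∧ ∀ e, r e < n e ^ (n e * (n e * n e)) ∧
      (InvariantHistories (caF (digitRule (n e) (r e))) ↔ ¬ p e) := by
  obtain ⟨N, A, T, h⟩ := exists_counterRule hp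
  let n (e : ℕ) : ℕ := (e + 1) * (N + 1)
  let g (e : ℕ) (s : Fin (n e) × Fin (n e) × Fin (n e)) : Fin (n e) :=
    finProdFinEquiv (counterRule e A T (finProdFinEquiv.symm s.1, finProdFinEquiv.symm s.2.1,
      finProdFinEquiv.symm s.2.2))
  have hn : Primrec n := Primrec.nat_mul.comp Primrec.succ (.const _)
  have hn2 : Primrec fun e => n e * n e := Primrec.nat_mul.comp hn hn
  refine ⟨n, fun e => ruleEquiv (n e) (g e), hn.to_comp, ?_, fun e => ⟨Fin.is_lt _, ?_⟩⟩
  · have hg : ∀ e, (ruleEquiv (n e) (g e) : ℕ) = _ := fun e =>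
      ruleEquiv_apply (g e) (G := natCounterRule A T e) fun a b c => by
        simpa only [Equiv.apply_symm_apply] using natCounterRule_eq A T
          (finProdFinEquiv.symm a, finProdFinEquiv.symm b, finProdFinEquiv.symm c)
    simp only [hg]
    refine computable_sum_range ?_ (Primrec.nat_mul.comp hn hn2).to_comp
    have h1 : Primrec fun x : ℕ × ℕ => n x.1 := hn.comp .fst
    have h2 : Primrec fun x : ℕ × ℕ => n x.1 * n x.1 := hn2.comp .fst
    have h3 := Primrec.nat_mod.comp .snd h2
    exact (Primrec.nat_mul.comp ((primrec_natCounterRule A T).comp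
      (Primrec.fst.pair ((Primrec.nat_div.comp .snd h2).pair
        ((Primrec.nat_div.comp h3 h1).pair (Primrec.nat_mod.comp h3 h1)))))
      (primrec_nat_pow.comp h1 .snd)).to_comp
  · rw [digitRule_ruleEquiv, ← h e]
    exact (invariantHistories_congr finProdFinEquiv.symm fun a b c => by simp [g]).symm

/-- The entry at time `s` and position `y` of the space-time diagram with digits `w`. -/
def entry (n w s y : ℕ) : ℕ := w / n ^ Nat.pair s y % n

theorem entry_lt {n : ℕ} (hn : 0 < n) (w s y : ℕ) : entry n w s y < n := Nat.mod_lt _ hn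

/-- The value of `digitRule n r` on numbers. -/
def digitValue (n r a b c : ℕ) : ℕ := r / n ^ (c + n * b + n * n * a) % n

/-- The diagram `w` is an asynchronous trajectory of `digitRule n r` on the time interval `[0, T]`
and the space interval `[0, 2 * T]`, the endpoints of which are never updated. -/
def IsDiagram (n r T w : ℕ) : Prop :=
  ∀ s < T, ∀ y < 2 * T + 1, entry n w (s + 1) y = entry n w s y ∨
    0 < y ∧ y < 2 * T ∧ entry n w (s + 1) y =
      digitValue n r (entry n w s (y - 1)) (entry n w s y) (entry n w s (y + 1))

/-- The effective age of the central site of a diagram at time `T`. -/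
def diagramAge (n T w : ℕ) : ℕ :=
  ∑ s ∈ Finset.range T, if entry n w (s + 1) T = entry n w s T then 0 else 1

/-- The diagrams `w` and `w'` have the same initial configuration and violate the invariance of
histories at the central site. -/
def IsViolation (n r T w w' : ℕ) : Prop :=
  0 < n ∧ IsDiagram n r T w ∧ IsDiagram n r T w' ∧
    (∀ y < 2 * T + 1, entry n w 0 y = entry n w' 0 y) ∧
    diagramAge n T w = diagramAge n T w' ∧ entry n w T T ≠ entry n w' T T

theorem effAge_eq_sum [DecidableEq S] (η : C → ℕ → S) (x : C) (t : ℕ) :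
    effAge η x t = ∑ s ∈ Finset.range t, if η x (s + 1) = η x s then 0 else 1 := by
  induction t with
  | zero => simp [effAge_zero]
  | succ t ih =>
    rw [Finset.sum_range_succ, ← ih]
    split_ifs with h
    · exact effAge_succ_of_eq h
    · exact effAge_succ_of_ne h

/-- The trajectory described by a diagram. -/
def diagramTraj {n : ℕ} (hn : 0 < n) (T w : ℕ) (p : ℤ) (s : ℕ) : Fin n :=
  if 0 ≤ p ∧ p ≤ 2 * T then ⟨entry n w (min s T) p.toNat, entry_lt hn _ _ _⟩ else ⟨0, hn⟩

theorem diagramTraj_natCast {n : ℕ} (hn : 0 < n) {T w y s : ℕ} (hy : y ≤ 2 * T) (hs : s ≤ T) :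
    (diagramTraj hn T w y s : ℕ) = entry n w s y := by
  rw [diagramTraj, if_pos (by omega)]
  simp only [min_eq_left hs, Int.toNat_natCast]

theorem IsDiagram.isAsyncTraj {n r T w : ℕ} (hn : 0 < n) (h : IsDiagram n r T w) :
    IsAsyncTraj (caF (digitRule n r)) (diagramTraj hn T w) := by
  intro p s hne
  have hp : 0 ≤ p ∧ p ≤ 2 * T := by
    by_contra hp
    simp [diagramTraj, hp] at hne
  have hs : s < T := by
    by_contra hs
    exact hne (by simp only [diagramTraj, min_eq_right (not_lt.1 hs),
      min_eq_right (show T ≤ s + 1 by omega)])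
  obtain ⟨y, rfl⟩ := Int.eq_ofNat_of_zero_le hp.1
  have hy : y ≤ 2 * T := by omega
  have h1 := diagramTraj_natCast hn (w := w) hy (show s + 1 ≤ T by omega)
  have h0 := diagramTraj_natCast hn (w := w) hy hs.le
  rcases h s hs y (by omega) with he | ⟨h0y, hy2, he⟩
  · exact absurd (Fin.ext (by rw [h1, h0, he])) hne
  · ext
    rw [h1, he, ← h0, ← diagramTraj_natCast hn (show y - 1 ≤ 2 * T by omega) hs.le,
      ← diagramTraj_natCast hn (show y + 1 ≤ 2 * T by omega) hs.le, Nat.cast_sub h0y,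
      Nat.cast_add]
    rfl

theorem effAge_diagramTraj {n : ℕ} (hn : 0 < n) (T w : ℕ) :
    effAge (diagramTraj hn T w) T T = diagramAge n T w := by
  rw [effAge_eq_sum, diagramAge]
  refine Finset.sum_congr rfl fun s hs => ?_
  have hs := Finset.mem_range.1 hs
  simp only [Fin.ext_iff, diagramTraj_natCast hn (show T ≤ 2 * T by omega) hs.le,
    diagramTraj_natCast hn (show T ≤ 2 * T by omega) (show s + 1 ≤ T from hs)]

theorem exists_entry_eq {n : ℕ} (F : ℕ → ℕ → Fin n) (B : ℕ) :
    ∃ w, ∀ s < B, ∀ y < B, entry n w s y = F s y := by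
  refine ⟨finFunctionFinEquiv fun i : Fin (B ^ 2) => F i.1.unpair.1 i.1.unpair.2,
    fun s hs y hy => ?_⟩
  have hB : Nat.pair s y < B ^ 2 :=
    (Nat.pair_lt_max_add_one_sq s y).trans_le (Nat.pow_le_pow_left (by omega) 2)
  have := finFunctionFinEquiv_symm_apply_val (finFunctionFinEquiv fun i : Fin (B ^ 2) =>
    F i.1.unpair.1 i.1.unpair.2) ⟨Nat.pair s y, hB⟩
  rw [Equiv.symm_apply_apply] at this
  simpa [entry] using this.symm

/-- The light cone of a site in a trajectory is described by a diagram. -/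
theorem exists_isDiagram {n r : ℕ} {η : ℤ → ℕ → Fin n}
    (hη : IsAsyncTraj (caF (digitRule n r)) η) (x : ℤ) (T : ℕ) :
    ∃ w, IsDiagram n r T w ∧ (∀ s ≤ T, entry n w s T = η x s) ∧
      ∀ y ≤ 2 * T, entry n w 0 y = η (x + y - T) 0 := by
  obtain ⟨w, hw⟩ := exists_entry_eq
    (fun s y => η (x + y - T) (min s (min y (2 * T - y)))) (2 * T + 1)
  refine ⟨w, fun s hs y hy => ?_, fun s hs => ?_, fun y hy => ?_⟩
  · rw [hw _ (by omega) _ hy, hw _ (by omega) _ hy]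
    rcases Nat.lt_or_ge s (min y (2 * T - y)) with hm | hm
    · rw [hw _ (by omega) _ (by omega), hw _ (by omega) _ (by omega),
        min_eq_left (show s + 1 ≤ min y (2 * T - y) from hm), min_eq_left hm.le,
        min_eq_left (show s ≤ min (y - 1) (2 * T - (y - 1)) by omega),
        min_eq_left (show s ≤ min (y + 1) (2 * T - (y + 1)) by omega)]
      by_cases hc : η (x + y - T) (s + 1) = η (x + y - T) s
      · exact .inl (congrArg _ hc)
      · refine .inr ⟨by omega, by omega, ?_⟩
        rw [hη _ _ hc, show (x + (y - 1 : ℕ) - T : ℤ) = x + y - T - 1 by omega,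
          show (x + (y + 1 : ℕ) - T : ℤ) = x + y - T + 1 by omega]
        rfl
    · left
      rw [min_eq_right hm, min_eq_right (hm.trans s.le_succ)]
  · rw [hw _ (by omega) _ (by omega), min_eq_left (by omega), add_sub_cancel_right]
  · rw [hw _ (by omega) _ (by omega), Nat.zero_min]

theorem not_invariantHistories_digitRule_iff (n r : ℕ) :
    ¬ InvariantHistories (caF (digitRule n r)) ↔ ∃ T w w', IsViolation n r T w w' := by
  rw [invariantHistories_iff_same_time]
  constructor
  · intro h
    push Not at h
    obtain ⟨η, η', hη, hη', h0, x, T, hage, hne⟩ := h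
    obtain ⟨w, hw, hc, hi⟩ := exists_isDiagram hη x T
    obtain ⟨w', hw', hc', hi'⟩ := exists_isDiagram hη' x T
    have age : ∀ {η : ℤ → ℕ → Fin n} {w : ℕ}, (∀ s ≤ T, entry n w s T = η x s) →
        diagramAge n T w = effAge η x T := fun {η w} hc => by
      rw [effAge_eq_sum, diagramAge]
      refine Finset.sum_congr rfl fun s hs => ?_
      have hs := Finset.mem_range.1 hs
      rw [hc _ hs.le, hc _ hs]
      simp only [Fin.ext_iff]
    refine ⟨T, w, w', (η x 0).pos, hw, hw', fun y hy => ?_, ?_, ?_⟩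
    · rw [hi _ (by omega), hi' _ (by omega), h0]
    · rw [age hc, age hc', hage]
    · rw [hc _ le_rfl, hc' _ le_rfl]
      exact fun h => hne (Fin.ext h)
  · rintro ⟨T, w, w', hn, hw, hw', h0, hage, hne⟩ h
    have := h _ _ (hw.isAsyncTraj hn) (hw'.isAsyncTraj hn) (fun p => ?_) T T
      (by rw [effAge_diagramTraj, effAge_diagramTraj, hage])
    · have := congrArg Fin.val this
      rw [diagramTraj_natCast hn (by omega) le_rfl,
        diagramTraj_natCast hn (by omega) le_rfl] at this
      exact hne this
    · simp only [diagramTraj, Nat.zero_min]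
      split_ifs with hp
      · exact Fin.ext (h0 _ (by omega))
      · rfl

section Primrec

variable {α : Type*} [Primcodable α]

theorem primrec_sum_range {f : α → ℕ → ℕ} {b : α → ℕ} (hf : Primrec₂ f) (hb : Primrec b) :
    Primrec fun a => ∑ i ∈ Finset.range (b a), f a i := by
  refine (Primrec.nat_rec' (h := fun a (p : ℕ × ℕ) => p.2 + f a p.1) hb (Primrec.const 0)
    ?_).of_eq fun a => ?_
  · exact (Primrec.nat_add.comp (Primrec.snd.comp .snd)
      (hf.comp .fst (Primrec.fst.comp .snd))).to₂
  · induction b a with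
    | zero => rfl
    | succ n ih => rw [Finset.sum_range_succ, ← ih]

theorem primrecPred_forall_lt {R : α → ℕ → Prop} {b : α → ℕ} (hR : PrimrecRel R)
    (hb : Primrec b) : PrimrecPred fun a => ∀ i < b a, R a i := by
  classical
  refine (Primrec.eq.comp (primrec_sum_range (f := fun a i => if R a i then 0 else 1)
    (Primrec.ite hR (.const 0) (.const 1)) hb) (.const 0)).of_eq fun a => ?_
  simp [Finset.sum_eq_zero_iff]

variable {n r T w s y : α → ℕ}

theorem primrec_entry (hn : Primrec n) (hw : Primrec w) (hs : Primrec s) (hy : Primrec y) :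
    Primrec fun a => entry (n a) (w a) (s a) (y a) :=
  Primrec.nat_mod.comp (Primrec.nat_div.comp hw
    (primrec_nat_pow.comp hn (Primrec₂.natPair.comp hs hy))) hn

theorem primrec_diagramAge (hn : Primrec n) (hT : Primrec T) (hw : Primrec w) :
    Primrec fun a => diagramAge (n a) (T a) (w a) := by
  refine primrec_sum_range ?_ hT
  refine Primrec.ite (Primrec.eq.comp ?_ ?_) (.const 0) (.const 1)
  · exact primrec_entry (hn.comp .fst) (hw.comp .fst) (Primrec.succ.comp .snd) (hT.comp .fst)
  · exact primrec_entry (hn.comp .fst) (hw.comp .fst) .snd (hT.comp .fst)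

theorem primrecPred_isDiagram (hn : Primrec n) (hr : Primrec r) (hT : Primrec T)
    (hw : Primrec w) : PrimrecPred fun a => IsDiagram (n a) (r a) (T a) (w a) := by
  refine primrecPred_forall_lt (primrecPred_forall_lt (α := α × ℕ) ?_
    (Primrec.succ.comp (Primrec.nat_mul.comp (.const 2) (hT.comp .fst)))) hT
  have hn' : Primrec fun x : (α × ℕ) × ℕ => n x.1.1 := hn.comp (Primrec.fst.comp .fst)
  have hr' : Primrec fun x : (α × ℕ) × ℕ => r x.1.1 := hr.comp (Primrec.fst.comp .fst)
  have hT' : Primrec fun x : (α × ℕ) × ℕ => T x.1.1 := hT.comp (Primrec.fst.comp .fst)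
  have hw' : Primrec fun x : (α × ℕ) × ℕ => w x.1.1 := hw.comp (Primrec.fst.comp .fst)
  have hs : Primrec fun x : (α × ℕ) × ℕ => x.1.2 := Primrec.snd.comp .fst
  have hy : Primrec fun x : (α × ℕ) × ℕ => x.2 := .snd
  have h0 := primrec_entry hn' hw' hs hy
  have h1 := primrec_entry hn' hw' (Primrec.succ.comp hs) hy
  have hl := primrec_entry hn' hw' hs (Primrec.pred.comp hy)
  have hr := primrec_entry hn' hw' hs (Primrec.succ.comp hy)
  refine (Primrec.eq.comp h1 h0).or ((Primrec.nat_lt.comp (.const 0) hy).and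
    ((Primrec.nat_lt.comp hy (Primrec.nat_mul.comp (.const 2) hT')).and (Primrec.eq.comp h1 ?_)))
  exact Primrec.nat_mod.comp (Primrec.nat_div.comp hr' (primrec_nat_pow.comp hn'
    (Primrec.nat_add.comp (Primrec.nat_add.comp hr (Primrec.nat_mul.comp hn' h0))
      (Primrec.nat_mul.comp (Primrec.nat_mul.comp hn' hn') hl)))) hn'

theorem primrecPred_isViolation {w' : α → ℕ} (hn : Primrec n) (hr : Primrec r) (hT : Primrec T)
    (hw : Primrec w) (hw' : Primrec w') :
    PrimrecPred fun a => IsViolation (n a) (r a) (T a) (w a) (w' a) := by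
  refine (Primrec.nat_lt.comp (.const 0) hn).and ((primrecPred_isDiagram hn hr hT hw).and
    ((primrecPred_isDiagram hn hr hT hw').and (PrimrecPred.and ?_
      ((Primrec.eq.comp (primrec_diagramAge hn hT hw) (primrec_diagramAge hn hT hw')).and
        (Primrec.eq.comp (primrec_entry hn hw hT hT) (primrec_entry hn hw' hT hT)).not))))
  refine primrecPred_forall_lt (Primrec.eq.comp ?_ ?_)
    (Primrec.succ.comp (Primrec.nat_mul.comp (.const 2) hT))
  · exact primrec_entry (hn.comp .fst) (hw.comp .fst) (.const 0) .snd
  · exact primrec_entry (hn.comp .fst) (hw'.comp .fst) (.const 0) .snd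

end Primrec

/-- Violations of invariant histories are enumerable. -/
theorem rePred_not_invariantHistories :
    REPred fun x : ℕ =>
      ¬ InvariantHistories (caF (digitRule (Nat.unpair x).1 (Nat.unpair x).2)) := by
  have hu := Primrec.unpair
  have hk : Primrec fun x : ℕ × ℕ => x.2.unpair := hu.comp .snd
  have hk2 := hu.comp (Primrec.snd.comp hk)
  have h := rePred_exists_nat (R := fun (x k : ℕ) => IsViolation x.unpair.1 x.unpair.2 k.unpair.1
    k.unpair.2.unpair.1 k.unpair.2.unpair.2) (primrecPred_isViolation
    (n := fun x : ℕ × ℕ => x.1.unpair.1) (r := fun x => x.1.unpair.2)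
    (Primrec.fst.comp (hu.comp .fst)) (Primrec.snd.comp (hu.comp .fst))
    (Primrec.fst.comp hk) (Primrec.fst.comp hk2) (Primrec.snd.comp hk2)).computablePred
  refine h.of_eq fun x => ?_
  rw [not_invariantHistories_digitRule_iff]
  constructor
  · rintro ⟨k, hk⟩
    exact ⟨_, _, _, hk⟩
  · rintro ⟨T, w, w', h⟩
    exact ⟨Nat.pair T (Nat.pair w w'), by simpa using h⟩

/-- It is undecidable, given n ∈ ℕ and a rule
g : Fin n × Fin n × Fin n → Fin n, whether the one-dimensional cellular automaton on ℤ
with state set Fin n and rule g has invariant histories. -/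
theorem invariantHistories_undecidable :
    ¬ ComputablePred
        (fun p : (Σ n : ℕ, Fin n × Fin n × Fin n → Fin n) =>
          InvariantHistories (caF p.2)) := by
  intro hdec
  have hc : Computable fun n : ℕ => n ^ (n * (n * n)) :=
    (primrec_nat_pow.comp .id (Primrec.nat_mul.comp .id (Primrec.nat_mul.comp .id .id))).to_comp
  obtain ⟨d, hd, hdP⟩ := exists_computable_of_card
    (P := fun n r => InvariantHistories (caF (digitRule n r))) hc (computable_card_rule hdec)
    rePred_not_invariantHistories fun n => Nat.card_congr <|
      (ruleEquiv n).symm.subtypeEquiv fun r => by rw [ruleEquiv_symm_apply]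
  obtain ⟨n, r, hn, hr, h⟩ := exists_digitRule
    (p := fun e => (Nat.Partrec.Code.eval (Denumerable.ofNat _ e) 0).Dom)
    (Nat.Partrec.Code.eval_part.comp (Primrec.ofNat _).to_comp (Computable.const 0)).dom_re
  refine ComputablePred.halting_problem 0 (ComputablePred.of_eq (p := fun c =>
    ¬ d (n (Encodable.encode c)) (r (Encodable.encode c)) = true) ?_ fun c => ?_)
  · have := hd.comp (hn.comp Computable.encode) (hr.comp Computable.encode (α := Nat.Partrec.Code))
    exact ComputablePred.not (ComputablePred.of_eq (Computable.computablePred (this.of_eq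
      fun c => Bool.decide_eq_true.symm)) fun _ => Iff.rfl)
  · rw [hdP _ _ (h _).1, (h _).2, not_not, Denumerable.ofNat_encode]

end AsyncUpdating
end

section
/- Let C = ℤ, S = {0,1}, N(x) = ℤ for every x, and define f : (ℤ → S) → (ℤ → S) by f(ξ)(x) = 1 if ξ(y) = 0 for all but finitely many y, and f(ξ)(x) = 0 otherwise. Then f is locally commutative but not commutative; in particular, for the configuration ξ₀ with ξ₀(x) = 0 for all x, one has f(ξ₀, ℤ)(−1) = 1 while f(ξ₀, {x : x ≥ 0}, {x : x < 0})(−1) = 0, even though {x : x ≥ 0} and {x : x < 0} are disjoint subsets of L(ξ₀). -/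
namespace AsyncUpdating

variable {C S : Type*}

open Classical in
/-- The transition function of the example: `f(ξ)(x) = 1` if `ξ(y) = 0` for all but
finitely many `y`, and `0` otherwise (with `N(x) = ℤ` for every `x`). -/
noncomputable def exF : (ℤ → Fin 2) → ℤ → Fin 2 :=
  fun ξ _ => if {y : ℤ | ξ y ≠ 0}.Finite then 1 else 0

theorem exF_congr_of_finite_ne {ξ ζ : ℤ → Fin 2} (h : {y | ξ y ≠ ζ y}.Finite) :
    exF ξ = exF ζ := by
  have key : {y | ξ y ≠ 0}.Finite ↔ {y | ζ y ≠ 0}.Finite := by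
    constructor <;> intro h' <;> refine (h.union h').subset fun y hy => ?_ <;>
      simp only [Set.mem_union, Set.mem_ofPred_eq] at hy ⊢ <;> grind
  funext x
  by_cases hζ : {y | ζ y ≠ 0}.Finite
  · rw [exF, exF, if_pos hζ, if_pos (key.2 hζ)]
  · rw [exF, exF, if_neg hζ, if_neg (mt key.1 hζ)]

theorem exF_zero (x : ℤ) : exF (fun _ => 0) x = 1 := by
  simp [exF]

theorem subset_freeSet_exF_zero (A : Set ℤ) : A ⊆ freeSet exF (fun _ => 0) := by
  intro x _
  simp [freeSet, exF_zero]

theorem exF_locallyCommutative : LocallyCommutative exF := by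
  intro ξ x y hxy _ _
  have h : exF (upd exF ξ {x}) = exF ξ := by
    refine exF_congr_of_finite_ne ((Set.finite_singleton x).subset fun z hz => ?_)
    by_contra hzx
    exact hz (if_neg hzx)
  funext z
  simp only [upd] at h ⊢
  rw [h]
  simp only [Set.mem_singleton_iff, Set.mem_insert_iff]
  grind

theorem upd_exF_nonneg_neg_apply_neg_one :
    upd exF (upd exF (fun _ => 0) {x : ℤ | 0 ≤ x}) {x : ℤ | x < 0} (-1) = 0 := by
  have h : {y : ℤ | upd exF (fun _ => 0) {x : ℤ | 0 ≤ x} y ≠ 0} = Set.Ici 0 := by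
    ext y
    simp [upd, exF_zero]
  rw [upd, if_pos (by simp), exF, h, if_neg (Set.Ici_infinite 0)]

/-- `exF` is locally commutative but not commutative; in particular, for
the all-0 configuration ξ₀ one has f(ξ₀, ℤ)(−1) = 1 while
f(ξ₀, {x : x ≥ 0}, {x : x < 0})(−1) = 0, even though the two sets are disjoint subsets
of L(ξ₀). -/
theorem exF_locallyCommutative_not_commutative :
    LocallyCommutative exF ∧ ¬ CommutativeRule exF ∧
    Disjoint {x : ℤ | 0 ≤ x} {x : ℤ | x < 0} ∧
    {x : ℤ | 0 ≤ x} ⊆ freeSet exF (fun _ => 0) ∧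
    {x : ℤ | x < 0} ⊆ freeSet exF (fun _ => 0) ∧
    upd exF (fun _ => 0) Set.univ (-1) = 1 ∧
    upd exF (upd exF (fun _ => 0) {x : ℤ | 0 ≤ x}) {x : ℤ | x < 0} (-1) = 0 := by
  have hd : Disjoint {x : ℤ | 0 ≤ x} {x : ℤ | x < 0} :=
    Set.disjoint_left.2 fun _ hx => not_lt_of_ge (Set.mem_ofPred.1 hx)
  refine ⟨exF_locallyCommutative, fun hc => ?_, hd, subset_freeSet_exF_zero _,
    subset_freeSet_exF_zero _, by simp [upd, exF_zero], upd_exF_nonneg_neg_apply_neg_one⟩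
  have h := congrFun (hc (fun _ => 0) _ _ hd (subset_freeSet_exF_zero _)
    (subset_freeSet_exF_zero _)) (-1)
  rw [upd_exF_nonneg_neg_apply_neg_one] at h
  simp [upd, exF_zero] at h

end AsyncUpdating
end

section
/- Let S be a set, g : S×S×S → S, and let f be the transition function of the one-dimensional cellular automaton on ℤ with rule g. Then f is locally commutative if and only if for all r₀, r₁, r₂, r₃ ∈ S with g(r₀,r₁,r₂) ≠ r₁ and g(r₁,r₂,r₃) ≠ r₂, both g(g(r₀,r₁,r₂), r₂, r₃) = g(r₁,r₂,r₃) and g(r₀, r₁, g(r₁,r₂,r₃)) = g(r₀,r₁,r₂) hold. -/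
namespace AsyncUpdating

variable {C S : Type*}

/-- Updating distinct sites `x`, `y` one after the other agrees with updating both at once
iff the update at `x` does not affect the value of `f` at `y`. -/
theorem upd_singleton_upd_singleton_eq_iff (f : (C → S) → C → S) (ξ : C → S) {x y : C}
    (hxy : x ≠ y) :
    upd f (upd f ξ {x}) {y} = upd f ξ {x, y} ↔ f (upd f ξ {x}) y = f ξ y := by
  constructor
  · intro h
    simpa [upd] using congrFun h y
  · intro h
    funext z
    by_cases hzy : z = y
    · subst hzy
      simpa [upd] using h
    · by_cases hzx : z = x <;> simp [upd, hzy, hzx, hxy]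

theorem locallyCommutative_iff (f : (C → S) → C → S) :
    LocallyCommutative f ↔
      ∀ (ξ : C → S) (x y : C), x ≠ y → f ξ x ≠ ξ x → f ξ y ≠ ξ y →
        f (upd f ξ {x}) y = f ξ y :=
  forall₃_congr fun ξ _ _ => forall_congr' fun hxy =>
    forall₂_congr fun _ _ => upd_singleton_upd_singleton_eq_iff f ξ hxy

/-- the one-dimensional cellular automaton on ℤ with rule g is locally
commutative iff for all r₀, r₁, r₂, r₃ with g(r₀,r₁,r₂) ≠ r₁ and g(r₁,r₂,r₃) ≠ r₂,
both g(g(r₀,r₁,r₂), r₂, r₃) = g(r₁,r₂,r₃) and g(r₀, r₁, g(r₁,r₂,r₃)) = g(r₀,r₁,r₂). -/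
theorem caF_locallyCommutative_iff {S : Type*} (g : S × S × S → S) :
    LocallyCommutative (caF g) ↔
      ∀ r₀ r₁ r₂ r₃ : S, g (r₀, r₁, r₂) ≠ r₁ → g (r₁, r₂, r₃) ≠ r₂ →
        g (g (r₀, r₁, r₂), r₂, r₃) = g (r₁, r₂, r₃) ∧
        g (r₀, r₁, g (r₁, r₂, r₃)) = g (r₀, r₁, r₂) := by
  rw [locallyCommutative_iff]
  constructor
  · intro h r₀ r₁ r₂ r₃ h₁ h₂
    let ξ : ℤ → S := fun z => if z = 0 then r₀ else if z = 1 then r₁ else if z = 2 then r₂ else r₃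
    have free₁ : caF g ξ 1 ≠ ξ 1 := by simpa [caF, ξ] using h₁
    have free₂ : caF g ξ 2 ≠ ξ 2 := by simpa [caF, ξ] using h₂
    constructor
    · simpa [caF, upd, ξ] using h ξ 1 2 (by norm_num) free₁ free₂
    · simpa [caF, upd, ξ] using h ξ 2 1 (by norm_num) free₂ free₁
  · intro h ξ x y hxy hx hy
    by_cases hl : y = x + 1
    · subst hl
      have hg := h (ξ (x - 1)) (ξ x) (ξ (x + 1)) (ξ (x + 1 + 1)) hx
        (by simpa [caF] using hy)
      simpa [caF, upd, add_assoc] using hg.1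
    · by_cases hr : x = y + 1
      · subst hr
        have hg := h (ξ (y - 1)) (ξ y) (ξ (y + 1)) (ξ (y + 1 + 1)) hy
          (by simpa [caF] using hx)
        have hne : y - 1 ≠ y + 1 := by omega
        simpa [caF, upd, hne] using hg.2
      · have hy₁ : y - 1 ≠ x := by omega
        have hy₂ : y + 1 ≠ x := Ne.symm hr
        simp [caF, upd, hxy.symm, hy₁, hy₂]

end AsyncUpdating
end

section
/- Let (C, S, N, f) be an automaton with f locally commutative. Let ξ be a configuration and let x₁, …, xₙ be distinct elements of L(ξ). Then f(ξ, {x₁}, {x₂}, …, {xₙ}) = f(ξ, {x₁, …, xₙ}), where f(ξ, E₁, …, Eₖ) denotes the iterated application f(…f(f(ξ,E₁),E₂)…,Eₖ). -/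
namespace AsyncUpdating

variable {C S : Type*}

/-- Updating one free site does not change the image under `f` at any other free site. -/
theorem LocallyCommutative.apply_upd_singleton {f : (C → S) → C → S}
    (hlc : LocallyCommutative f) {ξ : C → S} {x y : C} (hxy : x ≠ y)
    (hx : x ∈ freeSet f ξ) (hy : y ∈ freeSet f ξ) : f (upd f ξ {x}) y = f ξ y := by
  simpa [upd] using congrFun (hlc ξ x y hxy hx hy) y

/-- Updating one free site leaves all other free sites free. -/
theorem LocallyCommutative.mem_freeSet_upd_singleton {f : (C → S) → C → S}
    (hlc : LocallyCommutative f) {ξ : C → S} {x y : C} (hxy : x ≠ y)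
    (hx : x ∈ freeSet f ξ) (hy : y ∈ freeSet f ξ) : y ∈ freeSet f (upd f ξ {x}) := by
  have hval : upd f ξ {x} y = ξ y := by simp [upd, hxy.symm]
  change f (upd f ξ {x}) y ≠ upd f ξ {x} y
  rw [hlc.apply_upd_singleton hxy hx hy, hval]
  exact hy

/-- Updating the members of a duplicate-free list of free sites one after the other
is the same as updating them simultaneously. -/
theorem LocallyCommutative.foldl_upd_singleton {f : (C → S) → C → S}
    (hlc : LocallyCommutative f) (l : List C) (hl : l.Nodup) (ξ : C → S)
    (hfree : ∀ x ∈ l, x ∈ freeSet f ξ) :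
    l.foldl (fun ζ x => upd f ζ {x}) ξ = upd f ξ {x | x ∈ l} := by
  induction l generalizing ξ with
  | nil => funext z; simp [upd]
  | cons a l ih =>
    obtain ⟨hal, hl⟩ := List.nodup_cons.mp hl
    have ha : a ∈ freeSet f ξ := hfree a List.mem_cons_self
    have hne : ∀ x ∈ l, a ≠ x := fun x hx h => hal (h ▸ hx)
    have hfl : ∀ x ∈ l, x ∈ freeSet f ξ := fun x hx => hfree x (List.mem_cons_of_mem a hx)
    rw [List.foldl_cons, ih hl _ fun x hx =>
      hlc.mem_freeSet_upd_singleton (hne x hx) ha (hfl x hx)]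
    funext z
    by_cases hz : z ∈ l
    · have := hlc.apply_upd_singleton (hne z hz) ha (hfl z hz)
      simpa [upd, hz] using this
    · by_cases hza : z = a <;> simp [upd, hz, hza, hal]

/-- Let (C, S, N, f) be an automaton with f locally commutative. Let ξ be
a configuration and let x₁, …, xₙ be distinct elements of L(ξ). Then
f(ξ, {x₁}, {x₂}, …, {xₙ}) = f(ξ, {x₁, …, xₙ}). -/
theorem foldl_upd_singletons_eq_upd_range
    {C S : Type*} (N : C → Set C) (f : (C → S) → C → S)
    (hf : IsTransition N f) (hlc : LocallyCommutative f)
    (ξ : C → S) (n : ℕ) (xs : Fin n → C) (hinj : Function.Injective xs)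
    (hfree : ∀ i, xs i ∈ freeSet f ξ) :
    (List.ofFn xs).foldl (fun ζ x => upd f ζ {x}) ξ = upd f ξ (Set.range xs) := by
  have h := hlc.foldl_upd_singleton (List.ofFn xs) (List.nodup_ofFn.mpr hinj) ξ
    (by simpa [List.mem_ofFn] using hfree)
  simpa only [List.mem_ofFn', Set.ofPred_mem_eq] using h

end AsyncUpdating
end
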